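/- arXiv:1605.04340 — 3 statements merged into one kernel-verified Lean document; each statement's English description precedes it below -/
import Mathlib

section
/- For every integer r ≥ 1 there exists a real constant b_r > 0 with the following property: if N_r(n) denotes the number of simple graphs G on the labeled vertex set {1,…,n} such that G has exactly n + r edges, every vertex of G has degree 2 or 3, and G is 2-connected (connected and without cut vertices), then N_r(n) · (3r−1)! / (n! · n^{3r−1}) → b_r as n → ∞. -/
open Filter

/-- The degree of a vertex `v` in a simple graph `G`, as the number of its neighbors. -/
noncomputable def vdeg {V : Type*} (G : SimpleGraph V) (v : V) : ℕ :=
  (G.neighborSet v).ncard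

/-- The number of `2`-connected (connected, with no cut vertex) simple graphs on
`{1,…,n}` with exactly `n + r` edges whose vertex degrees are all `2` or `3`. -/
noncomputable def Nsmooth (r n : ℕ) : ℕ :=
  Nat.card {G : SimpleGraph (Fin n) //
    G.edgeSet.ncard = n + r ∧
    (∀ v : Fin n, vdeg G v = 2 ∨ vdeg G v = 3) ∧
    G.Connected ∧ ∀ v : Fin n, (G.induce ({v}ᶜ : Set (Fin n))).Connected}

namespace CubicKernel

open SimpleGraph

variable {V W : Type*}

/-! ### Connectivity through invariant predicates -/

/-- Every predicate which is invariant along the edges of `G` inside `S` is constant on `S`. -/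
def Rigid (G : SimpleGraph V) (S : Set V) : Prop :=
  ∀ P : V → Prop, (∀ a ∈ S, ∀ b ∈ S, G.Adj a b → (P a ↔ P b)) →
    ∀ a ∈ S, ∀ b ∈ S, (P a ↔ P b)

lemma connected_iff_rigid (G : SimpleGraph V) :
    G.Connected ↔ Nonempty V ∧ Rigid G Set.univ := by
  rw [connected_iff, and_comm]
  refine and_congr_right fun _ => ⟨fun h P hP a _ b _ => ?_, fun h a b => ?_⟩
  · obtain ⟨p⟩ := h a b
    induction p with
    | nil => rfl
    | cons hadj _ ih =>
      exact (hP _ trivial _ trivial hadj).trans (ih trivial trivial)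
  · refine (h (fun x => G.Reachable a x) (fun x _ y _ hxy => ?_) a trivial b trivial).1
      (Reachable.refl _)
    exact ⟨fun h => h.trans hxy.reachable, fun h => h.trans hxy.symm.reachable⟩

lemma induce_connected_iff_rigid (G : SimpleGraph V) (S : Set V) :
    (G.induce S).Connected ↔ S.Nonempty ∧ Rigid G S := by
  rw [connected_iff_rigid, Set.nonempty_coe_sort]
  refine and_congr_right fun _ => ⟨fun h P hP a ha b hb => ?_, fun h P hP a _ b _ => ?_⟩
  · exact h (fun x => P x) (fun x _ y _ hxy => hP x x.2 y y.2 hxy) ⟨a, ha⟩ trivial ⟨b, hb⟩ trivial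
  · have := h (fun x => ∃ hx : x ∈ S, P ⟨x, hx⟩) (fun x hx y hy hxy => ?_) a a.2 b b.2
    · simpa using this
    · have := hP ⟨x, hx⟩ trivial ⟨y, hy⟩ trivial hxy
      simpa [hx, hy] using this

/-- Connected graphs without cut vertex. -/
def TwoConn (G : SimpleGraph V) : Prop :=
  G.Connected ∧ ∀ v : V, (G.induce ({v}ᶜ : Set V)).Connected

lemma twoConn_iff_rigid [Nontrivial V] (G : SimpleGraph V) :
    TwoConn G ↔ Rigid G Set.univ ∧ ∀ v, Rigid G {v}ᶜ := by
  have h (v : V) : (({v}ᶜ : Set V)).Nonempty := exists_ne v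
  have hV : Nonempty V := inferInstance
  simp only [TwoConn, induce_connected_iff_rigid, h, true_and]
  rw [connected_iff_rigid, and_iff_right hV]

lemma Rigid.comap {G : SimpleGraph W} (φ : V ≃ W) {S : Set W} (h : Rigid G S) :
    Rigid (G.comap φ) (φ ⁻¹' S) := by
  intro P hP a ha b hb
  have := h (fun x => P (φ.symm x)) (fun x hx y hy hxy => hP _ (by simpa) _ (by simpa) (by simpa))
    (φ a) ha (φ b) hb
  simpa using this

lemma TwoConn.comap [Nontrivial V] [Nontrivial W] {G : SimpleGraph W} (h : TwoConn G) (φ : V ≃ W) :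
    TwoConn (G.comap φ) := by
  rw [twoConn_iff_rigid] at h ⊢
  refine ⟨h.1.comap φ, fun v => ?_⟩
  have := (h.2 (φ v)).comap φ
  convert this using 1
  ext x; simp

/-! ### Degrees -/

lemma sum_vdeg [Fintype V] (G : SimpleGraph V) : ∑ v, vdeg G v = 2 * G.edgeSet.ncard := by
  classical
  have h := G.sum_degrees_eq_twice_card_edges
  rw [← coe_edgeFinset, Set.ncard_coe_finset, ← h]
  refine Finset.sum_congr rfl fun v _ => ?_
  rw [vdeg, ← card_neighborFinset_eq_degree, ← Set.ncard_coe_finset, coe_neighborFinset]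

lemma vdeg_comap (G : SimpleGraph W) (φ : V ≃ W) (v : V) :
    vdeg (G.comap φ) v = vdeg G (φ v) := by
  have : G.neighborSet (φ v) = φ '' (G.comap φ).neighborSet v := by
    ext x
    simp only [mem_neighborSet, Set.mem_image, comap_adj]
    exact ⟨fun h => ⟨φ.symm x, by simpa⟩, by rintro ⟨y, hy, rfl⟩; exact hy⟩
  rw [vdeg, vdeg, this, Set.ncard_image_of_injective _ φ.injective]

/-! ### The class of graphs to be counted -/

/-- `2`-connected graphs with `m` edges and all degrees in `{2, 3}`. -/
def Smooth (m : ℕ) (G : SimpleGraph V) : Prop :=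
  G.edgeSet.ncard = m ∧ (∀ v, vdeg G v = 2 ∨ vdeg G v = 3) ∧ TwoConn G

lemma Smooth.nonempty_edgeSet {m : ℕ} {G : SimpleGraph V} (h : Smooth m G) :
    G.edgeSet.Nonempty := by
  obtain ⟨v⟩ := h.2.2.1.nonempty
  have hv : (G.neighborSet v).Nonempty := by
    apply Set.nonempty_of_ncard_ne_zero
    have := h.2.1 v
    rw [vdeg] at this
    omega
  obtain ⟨x, hx⟩ := hv
  exact ⟨s(v, x), hx⟩

lemma Smooth.nontrivial {m : ℕ} {G : SimpleGraph V} (h : Smooth m G) : Nontrivial V := by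
  obtain ⟨e, he⟩ := h.nonempty_edgeSet
  induction e with | _ u w
  exact ⟨u, w, G.ne_of_adj he⟩

lemma Smooth.comap [Fintype V] [Fintype W] {m : ℕ} {G : SimpleGraph W} (h : Smooth m G)
    (φ : V ≃ W) : Smooth m (G.comap φ) := by
  have := h.nontrivial
  have := φ.nontrivial
  refine ⟨?_, fun v => by simpa only [vdeg_comap] using h.2.1 (φ v), h.2.2.comap φ⟩
  have h1 := sum_vdeg (G.comap φ)
  have h2 := sum_vdeg G
  simp only [vdeg_comap] at h1
  rw [Equiv.sum_comp φ (vdeg G), h2, h.1] at h1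
  omega

lemma Smooth.card_vdeg_eq_two [Fintype V] {r : ℕ} {G : SimpleGraph V}
    (h : Smooth (Fintype.card V + r) G) :
    Nat.card {v // vdeg G v = 2} + 2 * r = Fintype.card V := by
  classical
  have h1 := sum_vdeg G
  have h2 : ∀ v, vdeg G v + (if vdeg G v = 2 then 1 else 0) = 3 := fun v => by
    rcases h.2.1 v with h | h <;> simp [h]
  have h3 := Finset.sum_congr (rfl : (Finset.univ : Finset V) = _) fun v _ => h2 v
  rw [Finset.sum_add_distrib, h1, h.1, Finset.sum_boole] at h3
  simp only [Finset.sum_const, Finset.card_univ, smul_eq_mul, Nat.cast_id] at h3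
  rw [Nat.card_eq_fintype_card, Fintype.card_subtype]
  omega

lemma Smooth.card_le [Fintype V] {m : ℕ} {G : SimpleGraph V} (h : Smooth m G) :
    Fintype.card V ≤ m := by
  have h1 := sum_vdeg G
  have : ∑ _v : V, 2 ≤ ∑ v, vdeg G v := Finset.sum_le_sum fun v _ => by
    rcases h.2.1 v with h | h <;> omega
  simp only [Finset.sum_const, Finset.card_univ, smul_eq_mul, h1, h.1] at this
  omega

/-! ### Attaching a vertex of degree two -/

/-- The graph obtained from `H` by joining a new vertex to both ends of `e`. -/
def attach (H : SimpleGraph V) (e : Sym2 V) : SimpleGraph (Option V) where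
  Adj
    | some x, some y => H.Adj x y
    | none, some x => x ∈ e
    | some x, none => x ∈ e
    | none, none => False
  symm := ⟨by rintro (_ | x) (_ | y) h <;> first | exact h | exact H.adj_symm h⟩
  loopless := ⟨by rintro (_ | x) h <;> first | exact h | exact H.loopless.irrefl _ h⟩

/-- The graph obtained from `H` by adding the edge `e`. -/
def addEdge (H : SimpleGraph V) (e : Sym2 V) : SimpleGraph V := H ⊔ fromEdgeSet {e}

section attach

variable (H : SimpleGraph V) (e : Sym2 V)

@[simp] lemma attach_some_some (x y : V) : (attach H e).Adj (some x) (some y) ↔ H.Adj x y := Iff.rfl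
@[simp] lemma attach_none_some (x : V) : (attach H e).Adj none (some x) ↔ x ∈ e := Iff.rfl
@[simp] lemma attach_some_none (x : V) : (attach H e).Adj (some x) none ↔ x ∈ e := Iff.rfl

lemma addEdge_adj (x y : V) : (addEdge H e).Adj x y ↔ H.Adj x y ∨ (s(x, y) = e ∧ x ≠ y) := by
  simp [addEdge]

variable {H e}

lemma vdeg_attach_none {u w : V} (huw : u ≠ w) : vdeg (attach H s(u, w)) none = 2 := by
  have : (attach H s(u, w)).neighborSet none = {some u, some w} := by
    ext x
    rcases x with _ | x <;> simp
  rw [vdeg, this, Set.ncard_pair (by simpa)]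

lemma vdeg_attach_of_notMem {x : V} (hx : x ∉ e) : vdeg (attach H e) (some x) = vdeg H x := by
  have : (attach H e).neighborSet (some x) = some '' H.neighborSet x := by
    ext y
    rcases y with _ | y <;> simp [hx]
  rw [vdeg, this, Set.ncard_image_of_injective _ (Option.some_injective _), vdeg]

lemma vdeg_addEdge_of_notMem {x : V} (hx : x ∉ e) : vdeg (addEdge H e) x = vdeg H x := by
  have : (addEdge H e).neighborSet x = H.neighborSet x := by
    ext z
    simp only [mem_neighborSet, addEdge_adj]
    have : s(x, z) ≠ e := by rintro rfl; simp at hx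
    grind
  rw [vdeg, this, vdeg]

lemma addEdge_of_mem (he : e ∈ H.edgeSet) : addEdge H e = H := by
  ext x y
  rw [addEdge_adj]
  refine ⟨?_, Or.inl⟩
  rintro (h | ⟨rfl, -⟩)
  exacts [h, he]

variable [Finite V]

lemma vdeg_attach_of_mem {x : V} (hx : x ∈ e) : vdeg (attach H e) (some x) = vdeg H x + 1 := by
  have : (attach H e).neighborSet (some x) = insert none (some '' H.neighborSet x) := by
    ext y
    rcases y with _ | y <;> simp [hx]
  rw [vdeg, this, Set.ncard_insert_of_notMem (by simp),
    Set.ncard_image_of_injective _ (Option.some_injective _), vdeg]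

lemma vdeg_addEdge_of_mem {x : V} (hd : ¬ e.IsDiag) (he : e ∉ H.edgeSet) (hx : x ∈ e) :
    vdeg (addEdge H e) x = vdeg H x + 1 := by
  obtain ⟨y, rfl⟩ := hx
  have : (addEdge H s(x, y)).neighborSet x = insert y (H.neighborSet x) := by
    ext z
    simp only [mem_neighborSet, addEdge_adj, Set.mem_insert_iff, Sym2.congr_right]
    have : x ≠ y := by simpa using hd
    grind
  rw [vdeg, this, Set.ncard_insert_of_notMem (by simpa using he), vdeg]

lemma vdeg_attach_eq_vdeg_addEdge (hd : ¬ e.IsDiag) (he : e ∉ H.edgeSet) (x : V) :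
    vdeg (attach H e) (some x) = vdeg (addEdge H e) x := by
  by_cases hx : x ∈ e
  · rw [vdeg_attach_of_mem hx, vdeg_addEdge_of_mem hd he hx]
  · rw [vdeg_attach_of_notMem hx, vdeg_addEdge_of_notMem hx]

lemma ncard_edgeSet_addEdge (hd : ¬ e.IsDiag) (he : e ∉ H.edgeSet) :
    (addEdge H e).edgeSet.ncard = H.edgeSet.ncard + 1 := by
  have : (addEdge H e).edgeSet = insert e H.edgeSet := by
    ext f
    simp only [addEdge, edgeSet_sup, edgeSet_fromEdgeSet, Set.mem_union, Set.mem_sdiff,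
      Set.mem_singleton_iff, Set.mem_insert_iff]
    grind [Sym2.mem_diagSet]
  rw [this, Set.ncard_insert_of_notMem he]

lemma ncard_edgeSet_attach (hd : ¬ e.IsDiag) :
    (attach H e).edgeSet.ncard = H.edgeSet.ncard + 2 := by
  classical
  have := Fintype.ofFinite V
  have h1 := sum_vdeg (attach H e)
  have h2 := sum_vdeg H
  induction e with | _ u w
  have huw : u ≠ w := by simpa using hd
  have h3 : ∀ x, vdeg (attach H s(u, w)) (some x) =
      vdeg H x + ((if x = u then 1 else 0) + if x = w then 1 else 0) := by
    intro x
    by_cases hx : x ∈ s(u, w)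
    · rw [vdeg_attach_of_mem hx]
      rcases Sym2.mem_iff.1 hx with rfl | rfl <;> simp [huw, huw.symm]
    · rw [vdeg_attach_of_notMem hx]
      simp only [Sym2.mem_iff, not_or] at hx
      simp [hx]
  rw [Fintype.sum_option, vdeg_attach_none huw, Finset.sum_congr rfl fun x _ => h3 x,
    Finset.sum_add_distrib, Finset.sum_add_distrib, h2] at h1
  simp only [Finset.sum_ite_eq', Finset.mem_univ, if_true] at h1
  omega

end attach

/-! ### Connectivity of attached graphs -/

lemma twoConn_attach {H : SimpleGraph V} {u w : V} (huw : u ≠ w) (hH : Rigid H Set.univ)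
    (hK : TwoConn (addEdge H s(u, w))) : TwoConn (attach H s(u, w)) := by
  have : Nontrivial V := ⟨u, w, huw⟩
  rw [twoConn_iff_rigid] at hK ⊢
  have key : ∀ S : Set V, Rigid (addEdge H s(u, w)) S → (u ∈ S ∨ w ∈ S) →
      ∀ T : Set (Option V), none ∈ T → (∀ x, some x ∈ T ↔ x ∈ S) → Rigid (attach H s(u, w)) T := by
    intro S hS huS T hnT hT P hP
    have hn : ∀ x ∈ S, x ∈ s(u, w) → (P none ↔ P (some x)) := fun x hx hxe =>
      hP _ hnT _ ((hT x).2 hx) hxe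
    have hc := hS (fun x => P (some x)) (fun a ha b hb hab => by
      rcases (addEdge_adj _ _ _ _).1 hab with hab | ⟨hab, -⟩
      · exact hP _ ((hT a).2 ha) _ ((hT b).2 hb) hab
      · exact (hn a ha (by simp [← hab])).symm.trans (hn b hb (by simp [← hab])))
    have hn' : ∀ x ∈ S, (P none ↔ P (some x)) := fun x hx => by
      rcases huS with h | h
      · exact (hn u h (by simp)).trans (hc u h x hx)
      · exact (hn w h (by simp)).trans (hc w h x hx)
    rintro (_ | a) ha (_ | b) hb
    · rfl
    · exact hn' b ((hT b).1 hb)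
    · exact (hn' a ((hT a).1 ha)).symm
    · exact hc a ((hT a).1 ha) b ((hT b).1 hb)
  refine ⟨key _ hK.1 (by simp) _ trivial (by simp), ?_⟩
  rintro (_ | x)
  · rintro P hP (_ | a) ha (_ | b) hb
    · rfl
    · simp at ha
    · simp at hb
    · exact hH (fun x => P (some x)) (fun a _ b _ hab => hP _ (by simp) _ (by simp) hab)
        a trivial b trivial
  · refine key _ (hK.2 x) ?_ _ (by simp) (by simp)
    by_contra! h
    simp only [Set.mem_compl_iff, Set.mem_singleton_iff, not_not] at h
    exact huw (h.1.trans h.2.symm)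

lemma TwoConn.of_attach {H : SimpleGraph V} {u w : V} (huw : u ≠ w)
    (h : TwoConn (attach H s(u, w))) : TwoConn (addEdge H s(u, w)) := by
  classical
  have : Nontrivial V := ⟨u, w, huw⟩
  rw [twoConn_iff_rigid] at h ⊢
  have key : ∀ S : Set V, ∀ T : Set (Option V), (∀ x, some x ∈ T ↔ x ∈ S) →
      Rigid (attach H s(u, w)) T → Rigid (addEdge H s(u, w)) S := by
    intro S T hT hR P hP a ha b hb
    have hH : ∀ x ∈ S, ∀ y ∈ S, H.Adj x y → (P x ↔ P y) := fun x hx y hy hxy =>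
      hP x hx y hy ((addEdge_adj _ _ _ _).2 (Or.inl hxy))
    have hn : ∀ x ∈ S, x ∈ s(u, w) → ((if u ∈ S then P u else P w) ↔ P x) := by
      intro x hx hxe
      rcases Sym2.mem_iff.1 hxe with rfl | rfl
      · simp [hx]
      · split_ifs with hu
        · exact hP u hu x hx ((addEdge_adj _ _ _ _).2 (Or.inr ⟨rfl, huw⟩))
        · rfl
    refine hR (fun x => x.elim (if u ∈ S then P u else P w) P) ?_ (some a) ((hT a).2 ha)
      (some b) ((hT b).2 hb)
    rintro (_ | x) hx (_ | y) hy hxy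
    · rfl
    · exact hn y ((hT y).1 hy) hxy
    · exact (hn x ((hT x).1 hx) hxy).symm
    · exact hH x ((hT x).1 hx) y ((hT y).1 hy) hxy
  exact ⟨key _ _ (by simp) h.1, fun v => key _ _ (by simp) (h.2 (some v))⟩

/-- Deleting an edge at a vertex of degree at least two from a `2`-connected graph leaves it
connected. -/
lemma rigid_of_twoConn_addEdge {H : SimpleGraph V} {u w : V}
    (hK : TwoConn (addEdge H s(u, w))) (hu : ∃ y, H.Adj u y) : Rigid H Set.univ := by
  obtain ⟨y, hy⟩ := hu
  have : Nontrivial V := ⟨u, y, hy.ne⟩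
  rw [twoConn_iff_rigid] at hK
  intro P hP
  have hc := hK.2 u P fun a ha b hb hab => by
    rcases (addEdge_adj _ _ _ _).1 hab with hab | ⟨hab, -⟩
    · exact hP a trivial b trivial hab
    · have : u ∈ s(a, b) := by simp [hab]
      rcases Sym2.mem_iff.1 this with rfl | rfl
      · simp at ha
      · simp at hb
  have hconst : ∀ x, P y ↔ P x := fun x => by
    by_cases hx : x = u
    · exact hx ▸ (hP u trivial y trivial hy).symm
    · exact hc y hy.ne' x hx
  exact fun a _ b _ => (hconst a).symm.trans (hconst b)

/-! ### Suppressing and inserting vertices of degree two -/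

section smooth

variable [Fintype V] {H : SimpleGraph V} {e : Sym2 V} {m : ℕ}

lemma Smooth.attach_of_addEdge (hd : ¬ e.IsDiag) (he : e ∉ H.edgeSet)
    (h : Smooth m (addEdge H e)) : Smooth (m + 1) (attach H e) := by
  induction e with | _ u w
  have huw : u ≠ w := by simpa using hd
  obtain ⟨h1, h2, h3⟩ := h
  refine ⟨?_, ?_, twoConn_attach huw (rigid_of_twoConn_addEdge h3 ?_) h3⟩
  · rw [ncard_edgeSet_addEdge hd he] at h1
    rw [ncard_edgeSet_attach hd, ← h1]
  · rintro (_ | x)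
    · exact Or.inl (vdeg_attach_none huw)
    · rw [vdeg_attach_eq_vdeg_addEdge hd he]
      exact h2 x
  · have := h2 u
    rw [vdeg_addEdge_of_mem hd he (by simp)] at this
    apply Set.nonempty_of_ncard_ne_zero (s := H.neighborSet u)
    rw [vdeg] at this
    omega

lemma Smooth.addEdge_of_attach (hd : ¬ e.IsDiag) (he : e ∉ H.edgeSet)
    (h : Smooth (m + 1) (attach H e)) : Smooth m (addEdge H e) := by
  induction e with | _ u w
  have huw : u ≠ w := by simpa using hd
  obtain ⟨h1, h2, h3⟩ := h
  refine ⟨?_, fun x => ?_, h3.of_attach huw⟩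
  · rw [ncard_edgeSet_attach hd] at h1
    rw [ncard_edgeSet_addEdge hd he]
    omega
  · rw [← vdeg_attach_eq_vdeg_addEdge hd he]
    exact h2 _

lemma Smooth.attach_of_mem (he : e ∈ H.edgeSet) (hdeg : ∀ x ∈ e, vdeg H x = 2)
    (h : Smooth m H) : Smooth (m + 2) (attach H e) := by
  have hd := H.not_isDiag_of_mem_edgeSet he
  refine ⟨by rw [ncard_edgeSet_attach hd, h.1], ?_, ?_⟩
  · rintro (_ | x)
    · induction e with | _ u w
      exact Or.inl (vdeg_attach_none (by simpa using hd))
    · by_cases hx : x ∈ e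
      · exact Or.inr (by rw [vdeg_attach_of_mem hx, hdeg x hx])
      · rw [vdeg_attach_of_notMem hx]
        exact h.2.1 x
  · induction e with | _ u w
    refine twoConn_attach (by simpa using hd) ?_ ?_
    · exact ((connected_iff_rigid H).1 h.2.2.1).2
    · rw [addEdge_of_mem he]
      exact h.2.2

lemma Smooth.vdeg_ne_one_of_attach (hV : 3 ≤ Fintype.card V) (he : e ∈ H.edgeSet)
    (h : Smooth m (attach H e)) {u : V} (hu : u ∈ e) : vdeg H u ≠ 1 := by
  classical
  obtain ⟨w, rfl⟩ := hu
  intro h1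
  have huw : u ≠ w := H.ne_of_adj he
  have hn : ∀ y, H.Adj u y → y = w := by
    obtain ⟨a, ha⟩ := Set.ncard_eq_one.1 h1
    have hw : w ∈ H.neighborSet u := he
    intro y (hy : y ∈ H.neighborSet u)
    rw [ha] at hw hy
    exact hy.trans hw.symm
  obtain ⟨t, ht⟩ : ∃ t, t ∉ ({u, w} : Finset V) := by
    by_contra! hc
    have := Finset.card_le_card (s := Finset.univ) (t := {u, w}) fun x _ => hc x
    have := Finset.card_le_two (a := u) (b := w)
    rw [Finset.card_univ] at *
    omega
  simp only [Finset.mem_insert, Finset.mem_singleton, not_or] at ht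
  have hr := ((induce_connected_iff_rigid _ _).1 (h.2.2.2 (some w))).2
    (fun x => x = none ∨ x = some u) ?_ none (by simp) (some t) (by simpa using ht.2)
  · simp [ht.1] at hr
  · rintro (_ | x) hx (_ | y) hy hxy
    · rfl
    · simp at hy hxy ⊢; tauto
    · simp at hx hxy ⊢; tauto
    · simp only [Set.mem_compl_iff, Set.mem_singleton_iff, Option.some.injEq] at hx hy
      simp only [attach_some_some] at hxy
      simp only [reduceCtorEq, Option.some.injEq, false_or]
      constructor
      · rintro rfl
        exact absurd (hn y hxy) hy
      · rintro rfl
        exact absurd (hn x hxy.symm) hx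

lemma Smooth.of_attach_of_mem (hV : 3 ≤ Fintype.card V) (he : e ∈ H.edgeSet)
    (h : Smooth (m + 2) (attach H e)) : Smooth m H := by
  have hd := H.not_isDiag_of_mem_edgeSet he
  refine ⟨?_, fun x => ?_, ?_⟩
  · have := h.1
    rw [ncard_edgeSet_attach hd] at this
    omega
  · have hx := h.2.1 (some x)
    by_cases hxe : x ∈ e
    · have := h.vdeg_ne_one_of_attach hV he hxe
      rw [vdeg_attach_of_mem hxe] at hx
      omega
    · rwa [vdeg_attach_of_notMem hxe] at hx
  · have := h.2.2
    rw [← addEdge_of_mem he]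
    induction e with | _ u w
    exact this.of_attach (by simpa using hd)

end smooth

/-! ### Counting -/

lemma addEdge_deleteEdges {G : SimpleGraph V} {e : Sym2 V} (he : e ∈ G.edgeSet) :
    addEdge (G.deleteEdges {e}) e = G := by
  ext x y
  rw [addEdge_adj, deleteEdges_adj]
  constructor
  · rintro (h | ⟨rfl, -⟩)
    exacts [h.1, he]
  · intro h
    by_cases hxy : s(x, y) = e
    · exact Or.inr ⟨hxy, h.ne⟩
    · exact Or.inl ⟨h, hxy⟩

lemma deleteEdges_addEdge {H : SimpleGraph V} {e : Sym2 V} (he : e ∉ H.edgeSet) :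
    (addEdge H e).deleteEdges {e} = H := by
  ext x y
  rw [deleteEdges_adj, addEdge_adj]
  constructor
  · rintro ⟨h | h, h'⟩
    exacts [h, absurd h.1 h']
  · exact fun h => ⟨Or.inl h, fun h' => he (h' ▸ h)⟩

lemma mem_edgeSet_addEdge {H : SimpleGraph V} {e : Sym2 V} (hd : ¬ e.IsDiag) :
    e ∈ (addEdge H e).edgeSet := by
  induction e with | _ u w
  exact (addEdge_adj _ _ _ _).2 (Or.inr ⟨rfl, by simpa using hd⟩)

lemma attach_injective {H H' : SimpleGraph V} {e e' : Sym2 V} (h : attach H e = attach H' e') :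
    H = H' ∧ e = e' := by
  constructor
  · ext x y
    rw [← attach_some_some H e, h, attach_some_some]
  · ext x
    rw [← attach_none_some H e, h, attach_none_some]

lemma exists_eq_attach {G : SimpleGraph (Option V)} (h : vdeg G none = 2) :
    ∃ (H : SimpleGraph V) (e : Sym2 V), ¬ e.IsDiag ∧ G = attach H e := by
  obtain ⟨a, b, hab, hG⟩ := Set.ncard_eq_two.1 h
  have hnone : none ∉ G.neighborSet none := by simp
  rcases a with _ | u
  · simp [hG] at hnone
  rcases b with _ | w
  · simp [hG] at hnone
  have hadj : ∀ x, G.Adj none (some x) ↔ x ∈ s(u, w) := fun x => by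
    rw [← mem_neighborSet, hG]
    simp
  refine ⟨G.comap some, s(u, w), by simpa using hab, ?_⟩
  ext x y
  rcases x with _ | x <;> rcases y with _ | y
  · simp
  · simp [hadj]
  · rw [G.adj_comm]
    simp [hadj]
  · simp

/-- The number of `2`-connected graphs on `Fin n` with `m` edges and degrees in `{2, 3}`. -/
noncomputable def numSmooth (n m : ℕ) : ℕ := Nat.card {G : SimpleGraph (Fin n) // Smooth m G}

/-- The number of such graphs on `n + 1` vertices in which a given vertex has degree `2`. -/
noncomputable def numRooted (n m : ℕ) : ℕ :=
  Nat.card {G : SimpleGraph (Option (Fin n)) // Smooth m G ∧ vdeg G none = 2}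

lemma numSmooth_eq_zero {n m : ℕ} (h : m < n) : numSmooth n m = 0 := by
  have : IsEmpty {G : SimpleGraph (Fin n) // Smooth m G} :=
    ⟨fun G => by have := G.2.card_le; rw [Fintype.card_fin] at this; omega⟩
  exact Nat.card_of_isEmpty

lemma card_rooted_at (n m : ℕ) (v : Fin (n + 1)) :
    Nat.card {G : SimpleGraph (Fin (n + 1)) // Smooth m G ∧ vdeg G v = 2} = numRooted n m := by
  let φ := finSuccEquiv' v
  refine Nat.card_congr
    { toFun := fun G => ⟨G.1.comap φ.symm, G.2.1.comap φ.symm, ?_⟩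
      invFun := fun G => ⟨G.1.comap φ, G.2.1.comap φ, ?_⟩
      left_inv := fun G => ?_
      right_inv := fun G => ?_ }
  · rw [vdeg_comap, finSuccEquiv'_symm_none, G.2.2]
  · rw [vdeg_comap, finSuccEquiv'_at, G.2.2]
  · ext x y
    simp
  · ext x y
    simp

lemma numSmooth_mul_eq (n r : ℕ) :
    numSmooth (n + 1) (n + 1 + r) * (n + 1 - 2 * r) = (n + 1) * numRooted n (n + 1 + r) := by
  classical
  let e : (Σ G : {G : SimpleGraph (Fin (n + 1)) // Smooth (n + 1 + r) G}, {v // vdeg G.1 v = 2}) ≃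
      Σ v : Fin (n + 1), {G : SimpleGraph (Fin (n + 1)) // Smooth (n + 1 + r) G ∧ vdeg G v = 2} :=
    { toFun := fun x => ⟨x.2.1, x.1.1, x.1.2, x.2.2⟩
      invFun := fun x => ⟨⟨x.2.1, x.2.2.1⟩, x.1, x.2.2.2⟩
      left_inv := fun _ => rfl
      right_inv := fun _ => rfl }
  have := Fintype.ofFinite {G : SimpleGraph (Fin (n + 1)) // Smooth (n + 1 + r) G}
  have h := Nat.card_congr e
  rw [Nat.card_sigma, Nat.card_sigma] at h
  simp only [card_rooted_at, Finset.sum_const, Finset.card_univ, Fintype.card_fin,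
    smul_eq_mul] at h
  rw [← h, numSmooth, Nat.card_eq_fintype_card, ← Finset.card_univ, ← smul_eq_mul,
    ← Finset.sum_const]
  refine Finset.sum_congr rfl fun G _ => ?_
  have hG := Smooth.card_vdeg_eq_two (r := r) (G := G.1) (by simpa using G.2)
  rw [Fintype.card_fin] at hG
  omega

/-- A graph of the class together with one of its edges. -/
abbrev EdgeRooted (n m : ℕ) : Type :=
  Σ G : {G : SimpleGraph (Fin n) // Smooth m G}, G.1.edgeSet

lemma card_edgeRooted (n m : ℕ) : Nat.card (EdgeRooted n m) = numSmooth n m * m := by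
  classical
  have := Fintype.ofFinite {G : SimpleGraph (Fin n) // Smooth m G}
  rw [Nat.card_sigma, Finset.sum_congr rfl fun G _ => (Nat.card_coe_set_eq _).trans G.2.1,
    Finset.sum_const, Finset.card_univ, smul_eq_mul, numSmooth, Nat.card_eq_fintype_card]

lemma numSmooth_mul_le_numRooted (n m : ℕ) : numSmooth n m * m ≤ numRooted n (m + 1) := by
  rw [← card_edgeRooted]
  refine Nat.card_le_card_of_injective
    (fun x : EdgeRooted n m => ⟨attach (x.1.1.deleteEdges {x.2.1}) x.2.1, ?_, ?_⟩) ?_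
  · refine Smooth.attach_of_addEdge (x.1.1.not_isDiag_of_mem_edgeSet x.2.2) (by simp) ?_
    rw [addEdge_deleteEdges x.2.2]
    exact x.1.2
  · obtain ⟨⟨G, hG⟩, e, he⟩ := x
    have := G.not_isDiag_of_mem_edgeSet he
    induction e with | _ u w
    exact vdeg_attach_none (by simpa using this)
  · rintro ⟨⟨G, hG⟩, e, he⟩ ⟨⟨G', hG'⟩, e', he'⟩ h
    obtain ⟨h1, rfl⟩ := attach_injective (Subtype.ext_iff.1 h)
    obtain rfl : G = G' := by
      exact (addEdge_deleteEdges he).symm.trans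
        ((congrArg (addEdge · e) h1).trans (addEdge_deleteEdges he'))
    rfl

lemma numRooted_le {n : ℕ} (hn : 3 ≤ n) (m : ℕ) :
    numRooted n (m + 2) ≤ numSmooth n (m + 1) * (m + 1) + numSmooth n m * m := by
  rw [← card_edgeRooted, ← card_edgeRooted, ← Nat.card_sum]
  let f : EdgeRooted n (m + 1) ⊕ EdgeRooted n m → SimpleGraph (Option (Fin n)) :=
    Sum.elim (fun x => attach (x.1.1.deleteEdges {x.2.1}) x.2.1) (fun x => attach x.1.1 x.2.1)
  have hf : ∀ G : {G : SimpleGraph (Option (Fin n)) // Smooth (m + 2) G ∧ vdeg G none = 2},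
      ∃ x, f x = G.1 := by
    rintro ⟨G, hG, h2⟩
    obtain ⟨H, e, hd, rfl⟩ := exists_eq_attach h2
    by_cases he : e ∈ H.edgeSet
    · exact ⟨Sum.inr ⟨⟨H, hG.of_attach_of_mem (by simpa) he⟩, e, he⟩, rfl⟩
    · refine ⟨Sum.inl ⟨⟨addEdge H e, hG.addEdge_of_attach hd he⟩, e, mem_edgeSet_addEdge hd⟩, ?_⟩
      simp [f, deleteEdges_addEdge he]
  choose g hg using hf
  exact Nat.card_le_card_of_injective g fun G G' h => Subtype.ext (by rw [← hg, h, hg])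

/-! ### Existence -/

lemma Smooth.subdivide [Fintype V] {m : ℕ} {G : SimpleGraph V} (h : Smooth m G) {e : Sym2 V}
    (he : e ∈ G.edgeSet) : Smooth (m + 1) (attach (G.deleteEdges {e}) e) := by
  refine Smooth.attach_of_addEdge (G.not_isDiag_of_mem_edgeSet he) (by simp) ?_
  rwa [addEdge_deleteEdges he]

lemma smooth_triangle : Smooth 3 (⊤ : SimpleGraph (Fin 3)) := by
  have h : ∀ v, vdeg (⊤ : SimpleGraph (Fin 3)) v = 2 := fun v => by
    have : (⊤ : SimpleGraph (Fin 3)).neighborSet v = {v}ᶜ := by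
      ext x
      simp [eq_comm]
    rw [vdeg, this, Set.ncard_compl, Set.ncard_singleton, Nat.card_eq_fintype_card,
      Fintype.card_fin]
  refine ⟨?_, fun v => Or.inl (h v), ?_⟩
  · have := sum_vdeg (⊤ : SimpleGraph (Fin 3))
    simp only [h, Finset.sum_const, Finset.card_univ, Fintype.card_fin, smul_eq_mul] at this
    omega
  · have hr : ∀ S, Rigid (⊤ : SimpleGraph (Fin 3)) S := fun S P hP a ha b hb => by
      by_cases hab : a = b
      · rw [hab]
      · exact hP a ha b hb hab
    exact (twoConn_iff_rigid _).2 ⟨hr _, fun _ => hr _⟩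

lemma exists_smooth (r : ℕ) : ∃ n, ∃ G : SimpleGraph (Fin n), Smooth (n + r) G := by
  induction r with
  | zero => exact ⟨3, ⊤, smooth_triangle⟩
  | succ r ih =>
    obtain ⟨n, G, hG⟩ := ih
    obtain ⟨e, he⟩ := hG.nonempty_edgeSet
    have hd := G.not_isDiag_of_mem_edgeSet he
    have h1 := hG.subdivide he
    induction e with | _ u w
    have huw : u ≠ w := by simpa using hd
    set G₁ := attach (G.deleteEdges {s(u, w)}) s(u, w)
    have he₁ : s(none, some u) ∈ G₁.edgeSet := Sym2.mem_mk_left u w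
    have h2 := h1.subdivide he₁
    set G₂ := attach (G₁.deleteEdges {s(none, some u)}) s(none, some u)
    have he₂ : s(none, some none) ∈ G₂.edgeSet :=
      Sym2.mem_mk_left none (some u)
    have h3 := h2.attach_of_mem he₂ (by
      intro x hx
      rcases Sym2.mem_iff.1 hx with rfl | rfl
      · exact vdeg_attach_none (by simp)
      · have h := vdeg_attach_eq_vdeg_addEdge (H := G₁.deleteEdges {s(none, some u)})
          (G₁.not_isDiag_of_mem_edgeSet he₁) (by simp) none
        rw [addEdge_deleteEdges he₁] at h
        exact h.trans (vdeg_attach_none huw))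
    have φ : Fin (n + 3) ≃ Option (Option (Option (Fin n))) := Fintype.equivOfCardEq (by simp)
    refine ⟨n + 3, (attach G₂ s(none, some none)).comap φ, ?_⟩
    convert h3.comap φ using 1
    omega

/-! ### Asymptotics -/

/-- The normalized counts of graphs of excess `r` on `k + 1 + 2 * r` vertices. -/
noncomputable def normCount (r k : ℕ) : ℝ :=
  (numSmooth (k + 1 + 2 * r) (k + 1 + 2 * r + r) : ℝ) * (k + 1).factorial /
    ((k + 1 + 2 * r).factorial * (k + 3 * r).factorial)

lemma normCount_nonneg (r k : ℕ) : 0 ≤ normCount r k := by unfold normCount; positivity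

lemma normCount_succ (r k : ℕ) :
    normCount r (k + 1) = (numRooted (k + 1 + 2 * r) (k + 1 + 2 * r + r + 1) : ℝ) *
      (k + 1).factorial / ((k + 1 + 2 * r).factorial * ((k + 3 * r + 1 : ℝ) *
        (k + 3 * r).factorial)) := by
  have h := numSmooth_mul_eq (k + 1 + 2 * r) r
  rw [show k + 1 + 2 * r + 1 - 2 * r = k + 2 by omega,
    show k + 1 + 2 * r + 1 + r = k + 1 + 2 * r + r + 1 by omega] at h
  have h' := congrArg (Nat.cast : ℕ → ℝ) h
  push_cast at h'
  unfold normCount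
  rw [show k + 1 + 1 + 2 * r = k + 1 + 2 * r + 1 by omega,
    show k + 1 + 2 * r + 1 + r = k + 1 + 2 * r + r + 1 by omega,
    show k + 1 + 3 * r = k + 3 * r + 1 by omega,
    Nat.factorial_succ (k + 1), Nat.factorial_succ (k + 1 + 2 * r), Nat.factorial_succ (k + 3 * r)]
  push_cast
  rw [div_eq_div_iff (by positivity) (by positivity)]
  linear_combination (((k + 1).factorial : ℝ) * (k + 1 + 2 * r).factorial *
    ((k + 3 * r + 1 : ℝ) * (k + 3 * r).factorial)) * h'

lemma normCount_eq (r k : ℕ) :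
    normCount r k = ((numSmooth (k + 1 + 2 * r) (k + 1 + 2 * r + r) *
      (k + 1 + 2 * r + r) : ℕ) : ℝ) *
      (k + 1).factorial / ((k + 1 + 2 * r).factorial * ((k + 3 * r + 1 : ℝ) *
        (k + 3 * r).factorial)) := by
  unfold normCount
  rw [div_eq_div_iff (by positivity) (by positivity)]
  push_cast
  ring

lemma normCount_monotone (r : ℕ) : Monotone (normCount r) := by
  refine monotone_nat_of_le_succ fun k => ?_
  rw [normCount_succ, normCount_eq]
  have := numSmooth_mul_le_numRooted (k + 1 + 2 * r) (k + 1 + 2 * r + r)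
  gcongr

lemma normCount_succ_le (r k : ℕ) (hk : 2 ≤ k) :
    normCount r (k + 1) ≤ normCount r k +
      ((numSmooth (k + 1 + 2 * r) (k + 3 * r) * (k + 3 * r) : ℕ) : ℝ) *
      (k + 1).factorial / ((k + 1 + 2 * r).factorial * ((k + 3 * r + 1 : ℝ) *
        (k + 3 * r).factorial)) := by
  rw [normCount_succ, normCount_eq, ← add_div, ← add_mul]
  have := numRooted_le (n := k + 1 + 2 * r) (by omega) (k + 3 * r)
  rw [show k + 1 + 2 * r + r = k + 3 * r + 1 by omega, ← Nat.cast_add]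
  gcongr

lemma normCount_succ_succ_le (r k : ℕ) (hk : 2 ≤ k) :
    normCount (r + 1) (k + 1) ≤ normCount (r + 1) k +
      normCount r (k + 2) * (1 / (k + 2 : ℝ) - 1 / (k + 3 : ℝ)) := by
  refine (normCount_succ_le (r + 1) k hk).trans (add_le_add le_rfl ?_)
  unfold normCount
  rw [show k + 2 + 1 + 2 * r = k + 1 + 2 * (r + 1) by omega,
    show k + 1 + 2 * (r + 1) + r = k + 3 * (r + 1) by omega,
    show k + 3 * (r + 1) = k + 2 + 3 * r + 1 by omega, Nat.factorial_succ (k + 2 + 3 * r),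
    Nat.factorial_succ (k + 2), Nat.factorial_succ (k + 1)]
  generalize numSmooth _ _ = N
  have h : (1 / (k + 2 : ℝ) - 1 / (k + 3 : ℝ)) = 1 / ((k + 2) * (k + 3)) := by
    field_simp
    ring
  rw [h, div_mul_div_comm, div_le_div_iff₀ (by positivity) (by positivity)]
  push_cast
  have h1 : (1 : ℝ) ≤ k + 3 * (r + 1) + 1 := by
    have : (0 : ℝ) ≤ k + 3 * (r + 1) := by positivity
    linarith
  have h2 := mul_le_mul_of_nonneg_left h1 (a := (N : ℝ) * (k + 2 + 3 * r + 1) * (k + 1).factorial *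
    (k + 1 + 2 * (r + 1)).factorial * (k + 2 + 3 * r).factorial * (k + 2) * (k + 3))
    (by positivity)
  linear_combination h2

lemma normCount_zero_succ_le (k : ℕ) (hk : 2 ≤ k) : normCount 0 (k + 1) ≤ normCount 0 k := by
  have h := normCount_succ_le 0 k hk
  rw [numSmooth_eq_zero (by omega)] at h
  simpa using h

lemma exists_normCount_le (r : ℕ) : ∃ B, ∀ k, normCount r k ≤ B := by
  suffices ∃ B, ∀ k ≥ 2, normCount r k ≤ B by
    obtain ⟨B, hB⟩ := this
    exact ⟨B, fun k => (normCount_monotone r (Nat.le_add_right k 2)).trans (hB _ (by omega))⟩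
  induction r with
  | zero =>
    refine ⟨normCount 0 2, fun k hk => ?_⟩
    induction k, hk using Nat.le_induction with
    | base => rfl
    | succ k hk ih => exact (normCount_zero_succ_le k hk).trans ih
  | succ r ih =>
    obtain ⟨B, hB⟩ := ih
    have hB0 : 0 ≤ B := (normCount_nonneg r 2).trans (hB 2 le_rfl)
    suffices ∀ k ≥ 2, normCount (r + 1) k + B / (k + 2 : ℝ) ≤ normCount (r + 1) 2 + B by
      refine ⟨_, fun k hk => le_trans ?_ (this k hk)⟩
      have : 0 ≤ B / (k + 2 : ℝ) := by positivity
      linarith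
    intro k hk
    induction k, hk using Nat.le_induction with
    | base =>
      push_cast
      linarith
    | succ k hk ih =>
      have h1 := normCount_succ_succ_le r k hk
      have h2 : (0 : ℝ) ≤ 1 / (k + 2 : ℝ) - 1 / (k + 3 : ℝ) := by
        rw [sub_nonneg]
        gcongr
        norm_num
      have h3 := mul_le_mul_of_nonneg_right (hB (k + 2) (by omega)) h2
      have h4 : B * (1 / (k + 2 : ℝ) - 1 / (k + 3 : ℝ)) = B / (k + 2) - B / (k + 3) := by ring
      push_cast
      rw [show (k : ℝ) + 1 + 2 = k + 3 by ring]
      linarith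

lemma exists_normCount_pos (r : ℕ) : ∃ k, 0 < normCount r k := by
  obtain ⟨n, G, hG⟩ := exists_smooth r
  have h := Smooth.card_vdeg_eq_two (r := r) (G := G) (by simpa using hG)
  rw [Fintype.card_fin] at h
  have hpos : 0 < numSmooth n (n + r) := by
    have : Nonempty {G : SimpleGraph (Fin n) // Smooth (n + r) G} := ⟨⟨G, hG⟩⟩
    exact Nat.card_pos
  have h' := numSmooth_mul_le_numRooted n (n + r)
  have h'' := numSmooth_mul_eq n r
  refine ⟨n - 2 * r, ?_⟩
  have hn : 0 < n := by
    obtain ⟨v⟩ := hG.2.2.1.nonempty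
    exact v.pos
  have : 0 < numSmooth (n + 1) (n + 1 + r) := by
    refine Nat.pos_of_ne_zero fun h0 => ?_
    rw [h0, zero_mul] at h''
    have hr : 0 < numRooted n (n + r + 1) := lt_of_lt_of_le (by positivity) h'
    rw [show n + r + 1 = n + 1 + r by omega] at hr
    exact (Nat.mul_pos n.succ_pos hr).ne h''
  unfold normCount
  rw [show n - 2 * r + 1 + 2 * r = n + 1 by omega]
  positivity

lemma exists_tendsto_normCount (r : ℕ) :
    ∃ b : ℝ, 0 < b ∧ Tendsto (normCount r) atTop (nhds b) := by
  obtain ⟨B, hB⟩ := exists_normCount_le r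
  have hbdd : BddAbove (Set.range (normCount r)) := ⟨B, by rintro _ ⟨k, rfl⟩; exact hB k⟩
  obtain ⟨k, hk⟩ := exists_normCount_pos r
  exact ⟨_, hk.trans_le (le_ciSup hbdd k), tendsto_atTop_ciSup (normCount_monotone r) hbdd⟩

lemma tendsto_ascFactorial_div (d a : ℕ) (c : ℝ) :
    Tendsto (fun k : ℕ => ((k + a).ascFactorial d : ℝ) / (k + c) ^ d) atTop (nhds 1) := by
  have h : ∀ i ∈ Finset.range d,
      Tendsto (fun k : ℕ => ((k : ℝ) + (a + i)) / (k + c)) atTop (nhds 1) := fun i _ => by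
    simpa [add_comm] using tendsto_add_mul_div_add_mul_atTop_nhds (a + i : ℝ) c 1 one_ne_zero
  have h' := tendsto_finsetProd _ h
  rw [Finset.prod_const_one] at h'
  refine h'.congr fun k => ?_
  rw [Nat.ascFactorial_eq_prod_range, Finset.prod_div_distrib, Finset.prod_const,
    Finset.card_range]
  push_cast
  simp only [add_assoc]

end CubicKernel

open CubicKernel

theorem count_twoConnected_cubic_kernel (r : ℕ) (hr : 1 ≤ r) :
    ∃ b : ℝ, 0 < b ∧
      Tendsto
        (fun n : ℕ =>
          (Nsmooth r n : ℝ) * ((3 * r - 1).factorial : ℝ) /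
            ((n.factorial : ℝ) * (n : ℝ) ^ (3 * r - 1)))
        atTop (nhds b) := by
  obtain ⟨b, hb, hlim⟩ := exists_tendsto_normCount r
  refine ⟨b * (1 * (3 * r - 1).factorial), by positivity, ?_⟩
  rw [← tendsto_add_atTop_iff_nat (1 + 2 * r)]
  refine (hlim.mul ((tendsto_ascFactorial_div (3 * r - 1) 2 (1 + 2 * r)).mul_const _)).congr
    fun k => ?_
  have hfac : ((k + 3 * r).factorial : ℝ) =
      (k + 1).factorial * ((k + 2).ascFactorial (3 * r - 1)) := by
    rw [← Nat.cast_mul, Nat.factorial_mul_ascFactorial]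
    congr 2
    omega
  have hN : Nsmooth r (k + 1 + 2 * r) = numSmooth (k + 1 + 2 * r) (k + 1 + 2 * r + r) := rfl
  have hasc : ((k + 2).ascFactorial (3 * r - 1) : ℝ) ≠ 0 := by
    exact_mod_cast (Nat.ascFactorial_pos _ _).ne'
  unfold normCount
  rw [← add_assoc k 1 (2 * r), hN, hfac]
  push_cast
  rw [← add_assoc (k : ℝ) 1 (2 * r)]
  have : (k + 1 + 2 * r : ℝ) ≠ 0 := by positivity
  field_simp
end

section
/- Let N_1(n) be the number of simple graphs G on the labeled vertex set {1,…,n} such that G has exactly n + 1 edges, every vertex has degree 2 or 3, and G is 2-connected (connected and without cut vertices). Then 24 · N_1(n) / (n! · n²) → 1 as n → ∞; equivalently, the constant b_1 governing this family equals 1/12. -/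
open Filter

/-- The number of `2`-connected (connected, with no cut vertex) simple graphs on
`{1,…,n}` with exactly `n + 1` edges whose vertex degrees are all `2` or `3`. -/
noncomputable def None' (n : ℕ) : ℕ :=
  Nat.card {G : SimpleGraph (Fin n) //
    G.edgeSet.ncard = n + 1 ∧
    (∀ v : Fin n, vdeg G v = 2 ∨ vdeg G v = 3) ∧
    G.Connected ∧ ∀ v : Fin n, (G.induce ({v}ᶜ : Set (Fin n))).Connected}

/-- No vertex deletion disconnects `G`: every property that propagates along the edges avoiding `x`
is constant on the vertices different from `x`. -/
def NoCutVertex {V : Type*} (G : SimpleGraph V) : Prop :=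
  ∀ x, ∀ f : V → Prop, (∀ a b, a ≠ x → b ≠ x → G.Adj a b → f a → f b) →
    ∀ a b, a ≠ x → b ≠ x → f a → f b

/-- A graph without cut vertices, with all degrees in `{2,3}` and with `2 * k` vertices of degree
`3`, so that it has excess `k`. -/
def IsExcess {V : Type*} (k : ℕ) (G : SimpleGraph V) : Prop :=
  (∀ v, vdeg G v = 2 ∨ vdeg G v = 3) ∧ {v | vdeg G v = 3}.ncard = 2 * k ∧ NoCutVertex G

/-- `G` arises from `H` by attaching a new vertex `none` to both ends of the edge `u v`, where the
edge `u v` may or may not be deleted. -/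
structure IsEar {V : Type*} (G : SimpleGraph (Option V)) (H : SimpleGraph V) (u v : V) : Prop where
  adj : H.Adj u v
  none_adj : ∀ x, G.Adj none (some x) ↔ x = u ∨ x = v
  some_adj : ∀ x y, ¬ (x = u ∧ y = v) → ¬ (x = v ∧ y = u) →
    (G.Adj (some x) (some y) ↔ H.Adj x y)

/-- Attach a new vertex to both ends of `u v`, keeping the edge `u v` only if `p` holds. -/
def attachEar {V : Type*} (H : SimpleGraph V) (u v : V) (p : Prop) : SimpleGraph (Option V) where
  Adj
    | none, none => False
    | none, some x => x = u ∨ x = v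
    | some x, none => x = u ∨ x = v
    | some x, some y => H.Adj x y ∧ (p ∨ (¬ (x = u ∧ y = v) ∧ ¬ (x = v ∧ y = u)))
  symm := ⟨by
    rintro (_ | x) (_ | y) h
    · exact h
    · exact h
    · exact h
    · have := H.adj_comm x y
      dsimp only at h ⊢
      tauto⟩
  loopless := ⟨by
    rintro (_ | x) h
    · exact h
    · exact H.loopless.irrefl x h.1⟩

/-- Delete the vertex `none` and add the edge `u v`. -/
def removeEar {V : Type*} (G : SimpleGraph (Option V)) (u v : V) : SimpleGraph V where
  Adj x y := G.Adj (some x) (some y) ∨ (x ≠ y ∧ ((x = u ∧ y = v) ∨ (x = v ∧ y = u)))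
  symm := ⟨by
    intro x y h
    have := G.adj_comm (some x) (some y)
    have := @ne_comm _ x y
    tauto⟩
  loopless := ⟨by
    rintro x (h | h)
    · exact G.loopless.irrefl _ h
    · exact h.1 rfl⟩

section

variable {V W : Type*}

theorem isEar_attachEar {H : SimpleGraph V} {u v : V} (h : H.Adj u v) (p : Prop) :
    IsEar (attachEar H u v p) H u v where
  adj := h
  none_adj x := by simp [attachEar]
  some_adj x y h1 h2 := by simp only [attachEar]; tauto

theorem attachEar_adj {H : SimpleGraph V} {u v : V} (h : H.Adj u v) (p : Prop) :
    (attachEar H u v p).Adj (some u) (some v) ↔ p := by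
  simp [attachEar, h]

theorem isEar_removeEar {G : SimpleGraph (Option V)} {u v : V} (huv : u ≠ v)
    (h : ∀ x, G.Adj none (some x) ↔ x = u ∨ x = v) : IsEar G (removeEar G u v) u v where
  adj := by simp [removeEar, huv]
  none_adj := h
  some_adj x y h1 h2 := by simp only [removeEar]; tauto

theorem IsEar.attachEar_eq {G : SimpleGraph (Option V)} {H : SimpleGraph V} {u v : V}
    (h : IsEar G H u v) {p : Prop} (hp : G.Adj (some u) (some v) ↔ p) :
    attachEar H u v p = G := by
  ext a b
  have huv := h.adj
  rcases a with _ | x <;> rcases b with _ | y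
  · simp [attachEar]
  · simp [attachEar, h.none_adj]
  · simp [attachEar, G.adj_comm (some x), h.none_adj]
  · have h1 := h.some_adj x y
    have h2 := G.adj_comm (some u) (some v)
    have h3 := H.adj_comm u v
    simp only [attachEar]
    by_cases c1 : x = u ∧ y = v
    · obtain ⟨rfl, rfl⟩ := c1; tauto
    · by_cases c2 : x = v ∧ y = u
      · obtain ⟨rfl, rfl⟩ := c2; tauto
      · tauto

theorem IsEar.removeEar_eq {G : SimpleGraph (Option V)} {H : SimpleGraph V} {u v : V}
    (h : IsEar G H u v) : removeEar G u v = H := by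
  ext x y
  have h1 := h.some_adj x y
  have h2 := h.adj
  have h3 := H.adj_comm u v
  have h4 := h.adj.ne
  have h5 := @SimpleGraph.ne_of_adj _ H x y
  simp only [removeEar]
  by_cases c1 : x = u ∧ y = v
  · obtain ⟨rfl, rfl⟩ := c1; tauto
  · by_cases c2 : x = v ∧ y = u
    · obtain ⟨rfl, rfl⟩ := c2; simp [h4.symm, h3.1 h2]
    · tauto

theorem IsEar.noCutVertex_iff {G : SimpleGraph (Option V)} {H : SimpleGraph V} {u v : V}
    (h : IsEar G H u v) (hV : ∃ w, w ≠ u ∧ w ≠ v) : NoCutVertex G ↔ NoCutVertex H := by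
  have huv := h.adj.ne
  have hn := h.none_adj
  have hn' : ∀ x, G.Adj (some x) none ↔ x = u ∨ x = v := fun x => by rw [G.adj_comm, hn]
  have hs := h.some_adj
  have hvu := h.adj.symm
  have hadj := h.adj
  constructor
  · intro hG x f hf a b ha hb hfa
    have key := hG (some x) (fun o => match o with
      | some y => f y
      | none => (x = u ∧ f v) ∨ (x ≠ u ∧ f u)) ?_ (some a) (some b) (by simpa) (by simpa) hfa
    · exact key
    rintro (_ | c) (_ | d) hc hd hcd
    · simp
    · have := (hn d).1 hcd
      simp only [ne_eq, Option.some.injEq] at hd ⊢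
      grind
    · have := (hn' c).1 hcd
      simp only [ne_eq, Option.some.injEq] at hc ⊢
      grind
    · simp only [ne_eq, Option.some.injEq] at hc hd ⊢
      grind
  · intro hH
    rintro (_ | x) f hf
    · obtain ⟨w, hwu, hwv⟩ := hV
      have h1 := hH u (fun y => f (some y)) (by
        intro c d hc hd hcd
        exact hf _ _ (by simp) (by simp) ((hs c d (by tauto) (by tauto)).2 hcd))
      have h2 := hH v (fun y => f (some y)) (by
        intro c d hc hd hcd
        exact hf _ _ (by simp) (by simp) ((hs c d (by tauto) (by tauto)).2 hcd))
      have h3 : ∀ y, f (some y) → f (some w) := by grind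
      have h4 : ∀ y, f (some w) → f (some y) := by grind
      rintro (_ | a) (_ | b) ha hb hfa
      · exact absurd rfl ha
      · exact absurd rfl ha
      · exact absurd rfl hb
      · exact h4 _ (h3 _ hfa)
    · have h1 := hH x (fun y => f (some y)) (by
        intro c d hc hd hcd hfc
        by_cases c1 : (c = u ∧ d = v) ∨ (c = v ∧ d = u)
        · have h2 : f none := hf (some c) none (by simpa) (by simp)
            ((hn' c).2 (by tauto)) hfc
          exact hf none (some d) (by simp) (by simpa) ((hn d).2 (by tauto)) h2
        · exact hf _ _ (by simpa) (by simpa) ((hs c d (by tauto) (by tauto)).2 hcd) hfc)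
      obtain ⟨w, hwx, hw⟩ : ∃ w, w ≠ x ∧ (w = u ∨ w = v) := by
        by_cases c : u = x
        · exact ⟨v, by grind, by simp⟩
        · exact ⟨u, c, by simp⟩
      have h2 : f none → f (some w) :=
        hf none (some w) (by simp) (by simpa) ((hn w).2 hw)
      have h3 : f (some w) → f none :=
        hf (some w) none (by simpa) (by simp) ((hn' w).2 hw)
      rintro (_ | a) (_ | b) ha hb hfa
      · exact hfa
      · exact h1 w b hwx (by simpa using hb) (h2 hfa)
      · exact h3 (h1 a w (by simpa using ha) hwx hfa)
      · exact h1 a b (by simpa using ha) (by simpa using hb) hfa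

theorem NoCutVertex.two_le_vdeg [Finite V] {G : SimpleGraph V} (h : NoCutVertex G)
    (hV : 3 ≤ Nat.card V) (u : V) : 2 ≤ vdeg G u := by
  by_contra! hlt
  have : Nontrivial V := Finite.one_lt_card_iff_nontrivial.1 (by omega)
  obtain ⟨w, hwu, hw⟩ : ∃ w, w ≠ u ∧ ∀ y, G.Adj u y → y = w := by
    by_cases hne : (G.neighborSet u).Nonempty
    · obtain ⟨w, hw⟩ := hne
      refine ⟨w, hw.ne', fun y hy => ?_⟩
      exact (Set.ncard_le_one (Set.toFinite _)).1 (Nat.lt_succ_iff.1 hlt) y hy w hw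
    · obtain ⟨w, hw⟩ := exists_ne u
      exact ⟨w, hw, fun y hy => absurd ⟨y, hy⟩ hne⟩
  obtain ⟨z, hz⟩ : ∃ z, z ∉ ({u, w} : Set V) := by
    by_contra! hall
    have h1 : ({u, w} : Set V) = Set.univ := Set.eq_univ_of_forall hall
    have h2 := Set.ncard_pair hwu.symm
    rw [h1, Set.ncard_univ] at h2
    omega
  simp only [Set.mem_insert_iff, Set.mem_singleton_iff, not_or] at hz
  have := h w (fun y => y = u) (by grind) u z hwu.symm hz.2 rfl
  exact hz.1 this

theorem vdeg_none {G : SimpleGraph (Option V)} {u v : V} (huv : u ≠ v)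
    (h : ∀ x, G.Adj none (some x) ↔ x = u ∨ x = v) : vdeg G none = 2 := by
  have : G.neighborSet none = {some u, some v} := by
    ext (_ | x) <;> simp [h]
  rw [vdeg, this, Set.ncard_pair (by simpa)]

theorem IsEar.vdeg_of_ne {G : SimpleGraph (Option V)} {H : SimpleGraph V} {u v : V}
    (h : IsEar G H u v) {x : V} (hu : x ≠ u) (hv : x ≠ v) :
    vdeg G (some x) = vdeg H x := by
  have : G.neighborSet (some x) = some '' H.neighborSet x := by
    ext (_ | y)
    · simp [G.adj_comm (some x), h.none_adj, hu, hv]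
    · simp [h.some_adj x y (by tauto) (by tauto)]
  rw [vdeg, this, Set.ncard_image_of_injective _ (Option.some_injective _), vdeg]

theorem IsEar.symm {G : SimpleGraph (Option V)} {H : SimpleGraph V} {u v : V}
    (h : IsEar G H u v) : IsEar G H v u where
  adj := h.adj.symm
  none_adj x := by rw [h.none_adj, or_comm]
  some_adj x y h1 h2 := h.some_adj x y h2 h1

theorem IsEar.vdeg_left [Finite V] {G : SimpleGraph (Option V)} {H : SimpleGraph V} {u v : V}
    (h : IsEar G H u v) (hG : G.Adj (some u) (some v)) : vdeg G (some u) = vdeg H u + 1 := by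
  have hne := h.adj.ne
  have : G.neighborSet (some u) = insert none (some '' H.neighborSet u) := by
    ext (_ | y)
    · simp [G.adj_comm (some u), h.none_adj]
    · by_cases c : y = v
      · subst c; simp [hG, h.adj]
      · simp [h.some_adj u y (by tauto) (by tauto)]
  rw [vdeg, this, Set.ncard_insert_of_notMem (by simp) (Set.toFinite _),
    Set.ncard_image_of_injective _ (Option.some_injective _), vdeg]

theorem IsEar.vdeg_left_of_not_adj [Finite V] {G : SimpleGraph (Option V)} {H : SimpleGraph V}
    {u v : V} (h : IsEar G H u v) (hG : ¬ G.Adj (some u) (some v)) :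
    vdeg G (some u) = vdeg H u := by
  have hne := h.adj.ne
  have : G.neighborSet (some u) = insert none (some '' (H.neighborSet u \ {v})) := by
    ext (_ | y)
    · simp [G.adj_comm (some u), h.none_adj]
    · by_cases c : y = v
      · subst c; simp [hG]
      · simp [h.some_adj u y (by tauto) (by tauto), c]
  rw [vdeg, this, Set.ncard_insert_of_notMem (by simp) (Set.toFinite _),
    Set.ncard_image_of_injective _ (Option.some_injective _)]
  exact Set.ncard_sdiff_singleton_add_one h.adj (Set.toFinite _)

theorem IsEar.isExcess_iff_of_not_adj [Finite V] {G : SimpleGraph (Option V)} {H : SimpleGraph V}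
    {u v : V} (h : IsEar G H u v) (hG : ¬ G.Adj (some u) (some v))
    (hV : ∃ w, w ≠ u ∧ w ≠ v) (k : ℕ) : IsExcess k G ↔ IsExcess k H := by
  have hdn : vdeg G none = 2 := vdeg_none h.adj.ne h.none_adj
  have hd : ∀ x, vdeg G (some x) = vdeg H x := by
    intro x
    by_cases hu : x = u
    · subst hu; exact h.vdeg_left_of_not_adj hG
    by_cases hv : x = v
    · subst hv; exact h.symm.vdeg_left_of_not_adj (by rwa [G.adj_comm])
    exact h.vdeg_of_ne hu hv
  have hset : {v | vdeg G v = 3} = some '' {v | vdeg H v = 3} := by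
    ext (_ | x) <;> simp [hd, hdn]
  unfold IsExcess
  rw [h.noCutVertex_iff hV, hset, Set.ncard_image_of_injective _ (Option.some_injective _)]
  simp [Option.forall, hd, hdn]

theorem isExcess_zero_iff [Finite V] {H : SimpleGraph V} :
    IsExcess 0 H ↔ (∀ v, vdeg H v = 2) ∧ NoCutVertex H := by
  unfold IsExcess
  rw [mul_zero, Set.ncard_eq_zero (Set.toFinite _), Set.eq_empty_iff_forall_notMem]
  simp only [Set.mem_ofPred_eq]
  grind

theorem IsEar.isExcess_one_iff_of_adj [Finite V] {G : SimpleGraph (Option V)} {H : SimpleGraph V}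
    {u v : V} (h : IsEar G H u v) (hG : G.Adj (some u) (some v))
    (hV : ∃ w, w ≠ u ∧ w ≠ v) (hV3 : 3 ≤ Nat.card V) : IsExcess 1 G ↔ IsExcess 0 H := by
  have hdn : vdeg G none = 2 := vdeg_none h.adj.ne h.none_adj
  have hdu := h.vdeg_left hG
  have hdv := h.symm.vdeg_left hG.symm
  have hd := @h.vdeg_of_ne
  have hpair : ({some u, some v} : Set (Option V)).ncard = 2 :=
    Set.ncard_pair (by simpa using h.adj.ne)
  rw [isExcess_zero_iff, IsExcess, h.noCutVertex_iff hV]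
  constructor
  · rintro ⟨h1, h2, h3⟩
    refine ⟨?_, h3⟩
    have hu := h3.two_le_vdeg hV3 u
    have hv := h3.two_le_vdeg hV3 v
    have hu3 : vdeg G (some u) = 3 := by have := h1 (some u); omega
    have hv3 : vdeg G (some v) = 3 := by have := h1 (some v); omega
    have hset : ({some u, some v} : Set (Option V)) = {v | vdeg G v = 3} := by
      refine Set.eq_of_subset_of_ncard_le ?_ (by omega) (Set.toFinite _)
      rintro x (rfl | rfl) <;> assumption
    intro x
    by_cases c1 : x = u
    · subst c1; omega
    by_cases c2 : x = v
    · subst c2; omega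
    rw [← hd c1 c2]
    refine (h1 (some x)).resolve_right fun h4 => ?_
    have : some x ∈ ({some u, some v} : Set (Option V)) := hset ▸ h4
    simp [c1, c2] at this
  · rintro ⟨h1, h2⟩
    have hset : {v | vdeg G v = 3} = ({some u, some v} : Set (Option V)) := by
      ext (_ | x)
      · simp [hdn]
      · have := h1 x
        by_cases c1 : x = u
        · subst c1; simp [hdu, this]
        by_cases c2 : x = v
        · subst c2; simp [hdv, this]
        simp [hd c1 c2, this, c1, c2]
    refine ⟨?_, by rw [hset, hpair], h2⟩
    rintro (_ | x)
    · exact Or.inl hdn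
    · have := h1 x
      by_cases c1 : x = u
      · subst c1; right; omega
      by_cases c2 : x = v
      · subst c2; right; omega
      left; rw [hd c1 c2, this]

theorem IsEar.not_isExcess_zero_of_adj [Finite V] {G : SimpleGraph (Option V)}
    {H : SimpleGraph V} {u v : V} (h : IsEar G H u v) (hG : G.Adj (some u) (some v))
    (hV : ∃ w, w ≠ u ∧ w ≠ v) (hV3 : 3 ≤ Nat.card V) : ¬ IsExcess 0 G := by
  rw [isExcess_zero_iff, h.noCutVertex_iff hV]
  rintro ⟨h1, h2⟩
  have := h2.two_le_vdeg hV3 u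
  have := h.vdeg_left hG
  have := h1 (some u)
  omega

theorem vdeg_iso {G : SimpleGraph V} {H : SimpleGraph W} (φ : G ≃g H) (v : V) :
    vdeg H (φ v) = vdeg G v := by
  have : H.neighborSet (φ v) = φ '' G.neighborSet v := by
    ext w
    obtain ⟨w, rfl⟩ := φ.surjective w
    simp [φ.map_adj_iff]
  rw [vdeg, this, Set.ncard_image_of_injective _ φ.injective, vdeg]

theorem NoCutVertex.of_iso {G : SimpleGraph V} {H : SimpleGraph W} (φ : G ≃g H)
    (h : NoCutVertex G) : NoCutVertex H := by
  intro x f hf a b ha hb hfa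
  obtain ⟨x, rfl⟩ := φ.surjective x
  obtain ⟨a, rfl⟩ := φ.surjective a
  obtain ⟨b, rfl⟩ := φ.surjective b
  refine h x (fun y => f (φ y)) (fun c d hc hd hcd => ?_) a b
    (fun e => ha (e ▸ rfl)) (fun e => hb (e ▸ rfl)) hfa
  exact hf _ _ (φ.injective.ne hc) (φ.injective.ne hd) (φ.map_adj_iff.2 hcd)

theorem IsExcess.of_iso {k : ℕ} {G : SimpleGraph V} {H : SimpleGraph W} (φ : G ≃g H)
    (h : IsExcess k G) : IsExcess k H := by
  refine ⟨fun w => ?_, ?_, h.2.2.of_iso φ⟩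
  · obtain ⟨v, rfl⟩ := φ.surjective w
    rw [vdeg_iso]; exact h.1 v
  · have : {w | vdeg H w = 3} = φ '' {v | vdeg G v = 3} := by
      ext w
      obtain ⟨w, rfl⟩ := φ.surjective w
      simp [vdeg_iso]
    rw [this, Set.ncard_image_of_injective _ φ.injective, h.2.1]

end

section

variable {V W α β : Type*}

theorem ncard_setOf_prod [Finite α] [Finite β] {P : α → Prop} {Q : α → β → Prop} {c : ℕ}
    (h : ∀ a, P a → {b | Q a b}.ncard = c) :
    {p : α × β | P p.1 ∧ Q p.1 p.2}.ncard = {a | P a}.ncard * c := by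
  classical
  have e : {p : α × β // P p.1 ∧ Q p.1 p.2} ≃ Σ a : {a // P a}, {b // Q a b} :=
    { toFun := fun p => ⟨⟨p.1.1, p.2.1⟩, ⟨p.1.2, p.2.2⟩⟩
      invFun := fun s => ⟨(s.1.1, s.2.1), s.1.2, s.2.2⟩
      left_inv := fun _ => rfl
      right_inv := fun _ => rfl }
  have := Fintype.ofFinite {a // P a}
  have h1 := Nat.card_congr e
  rw [Nat.card_sigma, Finset.sum_congr rfl (fun a _ => h a.1 a.2), Finset.sum_const,
    Finset.card_univ, ← Nat.card_eq_fintype_card, smul_eq_mul] at h1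
  exact h1

theorem sum_vdeg [Fintype V] {G : SimpleGraph V} (h : ∀ v, vdeg G v = 2 ∨ vdeg G v = 3) :
    ∑ v, vdeg G v = 2 * Fintype.card V + {v | vdeg G v = 3}.ncard := by
  classical
  have h1 : ∀ v, vdeg G v = 2 + if vdeg G v = 3 then 1 else 0 := by
    intro v
    rcases h v with h | h <;> simp [h]
  rw [Finset.sum_congr rfl (fun v _ => h1 v), Finset.sum_add_distrib, Finset.sum_const,
    Finset.sum_boole, Finset.card_univ, smul_eq_mul, mul_comm, Nat.cast_id,
    Set.ncard_eq_toFinset_card', Set.toFinset_ofPred]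

theorem ncard_setOf_adj [Fintype V] (G : SimpleGraph V) :
    {p : V × V | G.Adj p.1 p.2}.ncard = ∑ v, vdeg G v := by
  classical
  have e : {p : V × V // G.Adj p.1 p.2} ≃ Σ v : V, G.neighborSet v :=
    { toFun := fun p => ⟨p.1.1, ⟨p.1.2, p.2⟩⟩
      invFun := fun s => ⟨(s.1, s.2.1), s.2.2⟩
      left_inv := fun _ => rfl
      right_inv := fun _ => rfl }
  have h1 := Nat.card_congr e
  rw [Nat.card_sigma] at h1
  exact h1

/-- The number of graphs on `V` of excess `k`. -/
noncomputable def numExcess (k : ℕ) (V : Type*) : ℕ :=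
  {G : SimpleGraph V | IsExcess k G}.ncard

/-- The number of graphs of excess `k` on `Option V` in which `none` has degree `2`. -/
noncomputable def numExcessNone (k : ℕ) (V : Type*) : ℕ :=
  {G : SimpleGraph (Option V) | IsExcess k G ∧ vdeg G none = 2}.ncard

/-- The number of graphs of excess `k` on `Option V` in which `none` has exactly two neighbors,
one of which has been marked, and where the two neighbors are adjacent if and only if `p` holds. -/
noncomputable def numEar (k : ℕ) (V : Type*) (p : Prop) : ℕ :=
  {q : SimpleGraph (Option V) × V × V | IsExcess k q.1 ∧ q.2.1 ≠ q.2.2 ∧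
    (∀ x, q.1.Adj none (some x) ↔ x = q.2.1 ∨ x = q.2.2) ∧
    (q.1.Adj (some q.2.1) (some q.2.2) ↔ p)}.ncard

theorem numExcess_congr (k : ℕ) (e : V ≃ W) : numExcess k V = numExcess k W := by
  refine Set.ncard_congr (fun G _ => G.map e) ?_ ?_ ?_
  · intro G hG
    exact IsExcess.of_iso (SimpleGraph.Iso.map e G) hG
  · intro G H _ _ h
    exact SimpleGraph.map_injective e.toEmbedding h
  · intro H hH
    refine ⟨H.map e.symm, IsExcess.of_iso (SimpleGraph.Iso.map e.symm H) hH, ?_⟩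
    rw [SimpleGraph.map_map, Equiv.self_comp_symm, SimpleGraph.map_id]

theorem ncard_isExcess_vdeg_eq_two [Finite V] (k : ℕ) (v : Option V) :
    {G : SimpleGraph (Option V) | IsExcess k G ∧ vdeg G v = 2}.ncard = numExcessNone k V := by
  classical
  set e : Option V ≃ Option V := Equiv.swap none v
  refine Set.ncard_congr (fun G _ => G.map e) ?_ ?_ ?_
  · intro G hG
    refine ⟨IsExcess.of_iso (SimpleGraph.Iso.map e G) hG.1, ?_⟩
    have := vdeg_iso (SimpleGraph.Iso.map e G) v
    rw [hG.2, SimpleGraph.Iso.map_apply, Equiv.swap_apply_right] at this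
    exact this
  · intro G H _ _ h
    exact SimpleGraph.map_injective e.toEmbedding h
  · intro H hH
    refine ⟨H.map e, ⟨IsExcess.of_iso (SimpleGraph.Iso.map e H) hH.1, ?_⟩, ?_⟩
    · have := vdeg_iso (SimpleGraph.Iso.map e H) none
      rw [hH.2, SimpleGraph.Iso.map_apply, Equiv.swap_apply_left] at this
      exact this
    · rw [SimpleGraph.map_map, show e ∘ e = id from funext fun x => Equiv.swap_apply_self none v x,
        SimpleGraph.map_id]

theorem numExcess_option [Finite V] (k : ℕ) :
    numExcess k (Option V) * (Nat.card V + 1 - 2 * k) =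
      (Nat.card V + 1) * numExcessNone k V := by
  have h1 : {p : SimpleGraph (Option V) × Option V | IsExcess k p.1 ∧ vdeg p.1 p.2 = 2}.ncard =
      numExcess k (Option V) * (Nat.card V + 1 - 2 * k) := by
    refine ncard_setOf_prod (P := IsExcess k) (Q := fun G v => vdeg G v = 2) fun G hG => ?_
    have h2 : {v | vdeg G v = 2} = {v | vdeg G v = 3}ᶜ := by
      ext v
      have := hG.1 v
      simp only [Set.mem_ofPred_eq, Set.mem_compl_iff]
      omega
    rw [h2, Set.ncard_compl, hG.2.1, Finite.card_option]
  have h2 : {p : Option V × SimpleGraph (Option V) | True ∧ (IsExcess k p.2 ∧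
      vdeg p.2 p.1 = 2)}.ncard = {v : Option V | True}.ncard * numExcessNone k V :=
    ncard_setOf_prod (P := fun _ => True) fun v _ => ncard_isExcess_vdeg_eq_two k v
  rw [← h1, ← Finite.card_option, ← Set.ncard_univ, ← Set.ofPred_true, ← h2]
  refine Set.ncard_congr (fun p _ => p.swap) ?_ ?_ ?_
  · intro p hp; exact ⟨trivial, hp⟩
  · intro p q _ _ h; exact Prod.swap_injective h
  · intro p hp; exact ⟨p.swap, hp.2, rfl⟩

theorem two_mul_numExcessNone [Finite V] (k : ℕ) :
    2 * numExcessNone k V = numEar k V False + numEar k V True := by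
  have h1 : {q : SimpleGraph (Option V) × V × V | (IsExcess k q.1 ∧ vdeg q.1 none = 2) ∧
      q.2.1 ≠ q.2.2 ∧ (∀ x, q.1.Adj none (some x) ↔ x = q.2.1 ∨ x = q.2.2)}.ncard =
      numExcessNone k V * 2 := by
    refine ncard_setOf_prod (P := fun G => IsExcess k G ∧ vdeg G none = 2)
      (Q := fun G (q : V × V) => q.1 ≠ q.2 ∧ ∀ x, G.Adj none (some x) ↔ x = q.1 ∨ x = q.2)
      fun G hG => ?_
    obtain ⟨a, b, hab, hset⟩ := Set.ncard_eq_two.1 hG.2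
    have ha : G.Adj none a := by
      rw [← SimpleGraph.mem_neighborSet, hset]; simp
    have hb : G.Adj none b := by
      rw [← SimpleGraph.mem_neighborSet, hset]; simp
    obtain _ | a := a
    · exact absurd rfl ha.ne
    obtain _ | b := b
    · exact absurd rfl hb.ne
    have hadj : ∀ x, G.Adj none (some x) ↔ x = a ∨ x = b := by
      intro x
      rw [← SimpleGraph.mem_neighborSet, hset]; simp
    have hab : a ≠ b := by simpa using hab
    have : {q : V × V | q.1 ≠ q.2 ∧ ∀ x, G.Adj none (some x) ↔ x = q.1 ∨ x = q.2} =
        {(a, b), (b, a)} := by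
      ext ⟨x, y⟩
      simp only [hadj, Set.mem_ofPred_eq, Set.mem_insert_iff, Set.mem_singleton_iff,
        Prod.mk.injEq]
      constructor
      · rintro ⟨h1, h2⟩
        have h3 := h2 x
        have h4 := h2 y
        grind
      · grind
    rw [this, Set.ncard_pair (by simp [hab])]
  rw [mul_comm, ← h1, numEar, numEar, ← Set.ncard_union_eq]
  · congr 1
    ext ⟨G, u, v⟩
    have := @vdeg_none _ G u v
    simp only [Set.mem_ofPred_eq, Set.mem_union]
    tauto
  · rw [Set.disjoint_left]
    rintro ⟨G, u, v⟩ h h'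
    simp only [Set.mem_ofPred_eq] at h h'
    tauto

theorem numEar_eq [Finite V] {k l : ℕ} {p : Prop}
    (h : ∀ (G : SimpleGraph (Option V)) (H : SimpleGraph V) (u v : V), IsEar G H u v →
      (G.Adj (some u) (some v) ↔ p) → (IsExcess k G ↔ IsExcess l H)) :
    numEar k V p = numExcess l V * (2 * Nat.card V + 2 * l) := by
  have := Fintype.ofFinite V
  have h1 : {q : SimpleGraph V × V × V | IsExcess l q.1 ∧ q.1.Adj q.2.1 q.2.2}.ncard =
      numExcess l V * (2 * Nat.card V + 2 * l) := by
    refine ncard_setOf_prod (P := IsExcess l)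
      (Q := fun (G : SimpleGraph V) (q : V × V) => G.Adj q.1 q.2) fun G hG => ?_
    rw [ncard_setOf_adj, sum_vdeg hG.1, hG.2.1, Nat.card_eq_fintype_card]
  rw [← h1]
  symm
  refine Set.ncard_congr (fun q _ => (attachEar q.1 q.2.1 q.2.2 p, q.2)) ?_ ?_ ?_
  · rintro ⟨H, u, v⟩ ⟨hH, huv⟩
    have hE := isEar_attachEar huv p
    exact ⟨(h _ _ _ _ hE (attachEar_adj huv p)).2 hH, huv.ne, hE.none_adj, attachEar_adj huv p⟩
  · rintro ⟨H, u, v⟩ ⟨H', u', v'⟩ ⟨hH, huv⟩ ⟨hH', huv'⟩ heq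
    simp only [Prod.mk.injEq] at heq huv huv'
    obtain ⟨h2, rfl, rfl⟩ := heq
    rw [← (isEar_attachEar huv p).removeEar_eq, h2, (isEar_attachEar huv' p).removeEar_eq]
  · rintro ⟨G, u, v⟩ ⟨hG, huv, hn, hp⟩
    have hE := isEar_removeEar huv hn
    refine ⟨(removeEar G u v, u, v), ⟨(h _ _ _ _ hE hp).1 hG, hE.adj⟩, ?_⟩
    simp only [hE.attachEar_eq hp]

theorem exists_ne_ne_of_three_le_card [Finite V] (hV : 3 ≤ Nat.card V) (u v : V) :
    ∃ w, w ≠ u ∧ w ≠ v := by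
  by_contra! hall
  have h1 : ({u, v} : Set V) = Set.univ := by
    ext w
    have := hall w
    simp only [Set.mem_insert_iff, Set.mem_singleton_iff, Set.mem_univ, iff_true]
    tauto
  have h2 := Set.ncard_insert_le u {v}
  rw [h1, Set.ncard_univ, Set.ncard_singleton] at h2
  omega

theorem numExcess_zero_option [Finite V] (hV : 3 ≤ Nat.card V) :
    numExcess 0 (Option V) = Nat.card V * numExcess 0 V := by
  have h1 := numExcess_option (V := V) 0
  have h2 := two_mul_numExcessNone (V := V) 0
  have h3 : numEar 0 V False = numExcess 0 V * (2 * Nat.card V + 2 * 0) :=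
    numEar_eq fun G H u v hE hp =>
      hE.isExcess_iff_of_not_adj (by tauto) (exists_ne_ne_of_three_le_card hV u v) 0
  have h4 : numEar 0 V True = 0 := by
    rw [numEar, Set.ncard_eq_zero (Set.toFinite _), Set.eq_empty_iff_forall_notMem]
    rintro ⟨G, u, v⟩ ⟨hG, huv, hn, hp⟩
    exact (isEar_removeEar huv hn).not_isExcess_zero_of_adj (hp.2 trivial)
      (exists_ne_ne_of_three_le_card hV u v) hV hG
  have h5 : numExcess 0 (Option V) * (Nat.card V + 1) = Nat.card V * numExcess 0 V *
      (Nat.card V + 1) := by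
    rw [mul_zero, Nat.sub_zero] at h1
    rw [h1, show numExcessNone 0 V = Nat.card V * numExcess 0 V by nlinarith]
    ring
  exact Nat.eq_of_mul_eq_mul_right (Nat.succ_pos _) h5

theorem numExcess_one_option [Finite V] (hV : 3 ≤ Nat.card V) :
    numExcess 1 (Option V) * (Nat.card V - 1) =
      (Nat.card V + 1) * (numExcess 1 V * (Nat.card V + 1) + numExcess 0 V * Nat.card V) := by
  have h1 := numExcess_option (V := V) 1
  have h2 := two_mul_numExcessNone (V := V) 1
  have h3 : numEar 1 V False = numExcess 1 V * (2 * Nat.card V + 2 * 1) :=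
    numEar_eq fun G H u v hE hp =>
      hE.isExcess_iff_of_not_adj (by tauto) (exists_ne_ne_of_three_le_card hV u v) 1
  have h4 : numEar 1 V True = numExcess 0 V * (2 * Nat.card V + 2 * 0) :=
    numEar_eq fun G H u v hE hp =>
      hE.isExcess_one_iff_of_adj (by tauto) (exists_ne_ne_of_three_le_card hV u v) hV
  have h5 : Nat.card V + 1 - 2 * 1 = Nat.card V - 1 := by omega
  rw [← h5, h1]
  congr 1
  linarith

theorem vdeg_lt_card [Finite V] (G : SimpleGraph V) (v : V) : vdeg G v < Nat.card V := by
  rw [← Set.ncard_univ]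
  exact Set.ncard_lt_ncard ((Set.ssubset_univ_iff).2 fun h =>
    G.loopless.irrefl v (h ▸ Set.mem_univ v : v ∈ G.neighborSet v)) (Set.toFinite _)

theorem numExcess_one_of_card_eq_three [Finite V] (hV : Nat.card V = 3) : numExcess 1 V = 0 := by
  rw [numExcess, Set.ncard_eq_zero (Set.toFinite _), Set.eq_empty_iff_forall_notMem]
  intro G hG
  have h : {v | vdeg G v = 3} = ∅ := by
    rw [Set.eq_empty_iff_forall_notMem]
    intro v hv
    have := vdeg_lt_card G v
    simp only [Set.mem_ofPred_eq] at hv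
    omega
  have := hG.2.1
  rw [h, Set.ncard_empty] at this
  omega

theorem numExcess_zero_of_card_eq_three [Finite V] (hV : Nat.card V = 3) :
    numExcess 0 V = 1 := by
  rw [numExcess, Set.ncard_eq_one]
  refine ⟨⊤, ?_⟩
  ext G
  simp only [Set.mem_ofPred_eq, Set.mem_singleton_iff, isExcess_zero_iff]
  have hc : ∀ v : V, ({v}ᶜ : Set V).ncard = 2 := fun v => by
    rw [Set.ncard_compl, hV, Set.ncard_singleton]
  constructor
  · rintro ⟨h, -⟩
    ext a b
    have hsub : G.neighborSet a = {a}ᶜ := by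
      refine Set.eq_of_subset_of_ncard_le ?_ (by rw [hc]; exact (h a).ge) (Set.toFinite _)
      intro b hb
      exact (SimpleGraph.Adj.ne hb).symm
    rw [← SimpleGraph.mem_neighborSet, hsub, SimpleGraph.top_adj]
    simp [eq_comm]
  · rintro rfl
    refine ⟨fun v => ?_, fun x f hf a b ha hb hfa => ?_⟩
    · rw [vdeg, SimpleGraph.neighborSet_top, hc]
    · by_cases hab : a = b
      · exact hab ▸ hfa
      · exact hf a b ha hb (by simpa) hfa

theorem two_mul_numExcess_zero (m : ℕ) :
    2 * numExcess 0 (Fin (m + 3)) = (m + 2).factorial := by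
  induction m with
  | zero => simp [numExcess_zero_of_card_eq_three (V := Fin 3) (by simp)]
  | succ m ih =>
    rw [numExcess_congr 0 (finSuccEquiv (m + 3)), numExcess_zero_option (by simp),
      Nat.factorial_succ, ← ih, Nat.card_fin]
    ring

theorem numExcess_one (m : ℕ) :
    24 * numExcess 1 (Fin (m + 3)) = (m + 3).factorial * (m * (m + 5)) := by
  induction m with
  | zero => simp [numExcess_one_of_card_eq_three (V := Fin 3) (by simp)]
  | succ m ih =>
    have h0 := two_mul_numExcess_zero m
    have h1 := numExcess_one_option (V := Fin (m + 3)) (by simp)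
    rw [← numExcess_congr 1 (finSuccEquiv (m + 3)), Nat.card_fin,
      show m + 3 - 1 = m + 2 by omega] at h1
    have hf : (m + 3).factorial = (m + 3) * (m + 2).factorial := Nat.factorial_succ _
    have hf' : (m + 4).factorial = (m + 4) * ((m + 3) * (m + 2).factorial) := by
      rw [← hf]; exact Nat.factorial_succ _
    rw [hf] at ih
    rw [show m + 1 + 3 = m + 4 by omega, hf']
    refine Nat.eq_of_mul_eq_mul_right (show 0 < m + 2 by omega) ?_
    calc 24 * numExcess 1 (Fin (m + 4)) * (m + 2)
        = (m + 4) * ((24 * numExcess 1 (Fin (m + 3))) * (m + 4) +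
          12 * (2 * numExcess 0 (Fin (m + 3))) * (m + 3)) := by
            rw [mul_assoc, h1]; ring
      _ = _ := by rw [ih, h0]; ring

theorem noCutVertex_iff (G : SimpleGraph V) :
    NoCutVertex G ↔ ∀ x, (G.induce ({x}ᶜ : Set V)).Preconnected := by
  constructor
  · intro h x ⟨a, ha⟩ ⟨b, hb⟩
    refine (h x (fun y => ∃ hy : y ∈ ({x}ᶜ : Set V),
      (G.induce ({x}ᶜ : Set V)).Reachable ⟨a, ha⟩ ⟨y, hy⟩) ?_ a b ha hb ⟨ha, .rfl⟩).2
    rintro c d hc hd hcd ⟨_, h⟩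
    refine ⟨hd, h.trans (SimpleGraph.Adj.reachable ?_)⟩
    simpa using hcd
  · intro h x f hf a b ha hb hfa
    obtain ⟨w⟩ := h x ⟨a, ha⟩ ⟨b, hb⟩
    have key : ∀ (c d : ({x}ᶜ : Set V)), (G.induce ({x}ᶜ : Set V)).Walk c d → f c → f d := by
      intro c d w
      induction w with
      | nil => exact id
      | @cons c d _ hadj _ ih => exact fun hc => ih (hf _ _ c.2 d.2 hadj hc)
    exact key _ _ w hfa

theorem NoCutVertex.preconnected [Finite V] {G : SimpleGraph V} (h : NoCutVertex G)
    (hV : 3 ≤ Nat.card V) : G.Preconnected := by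
  intro a b
  obtain ⟨x, hxa, hxb⟩ := exists_ne_ne_of_three_le_card hV a b
  exact h x (fun y => G.Reachable a y) (fun c d _ _ hcd hc => hc.trans hcd.reachable) a b
    hxa.symm hxb.symm .rfl

theorem isExcess_one_iff [Finite V] (hV : 3 ≤ Nat.card V) (G : SimpleGraph V) :
    IsExcess 1 G ↔ G.edgeSet.ncard = Nat.card V + 1 ∧ (∀ v, vdeg G v = 2 ∨ vdeg G v = 3) ∧
      G.Connected ∧ ∀ v, (G.induce ({v}ᶜ : Set V)).Connected := by
  classical
  have := Fintype.ofFinite V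
  have hsum : ∑ v, vdeg G v = 2 * G.edgeSet.ncard := by
    have h := G.sum_degrees_eq_twice_card_edges
    rw [← SimpleGraph.coe_edgeFinset, Set.ncard_coe_finset, ← h]
    refine Finset.sum_congr rfl fun v _ => ?_
    rw [vdeg, Set.ncard_eq_toFinset_card']
    rfl
  have hne : Nonempty V := (Nat.card_pos_iff.1 (by omega)).1
  have hne' : ∀ v : V, Nonempty ({v}ᶜ : Set V) := fun v => by
    obtain ⟨w, hw, -⟩ := exists_ne_ne_of_three_le_card hV v v
    exact ⟨⟨w, hw⟩⟩
  simp only [SimpleGraph.connected_iff, hne, hne', and_true, ← noCutVertex_iff]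
  rw [IsExcess, Nat.card_eq_fintype_card]
  constructor
  · rintro ⟨h1, h2, h3⟩
    have := sum_vdeg h1
    exact ⟨by omega, h1, h3.preconnected hV, h3⟩
  · rintro ⟨h1, h2, -, h3⟩
    have := sum_vdeg h2
    exact ⟨h2, by omega, h3⟩

theorem None'_eq_numExcess {n : ℕ} (hn : 3 ≤ n) : None' n = numExcess 1 (Fin n) := by
  have h : ∀ G : SimpleGraph (Fin n), _ := isExcess_one_iff (by simpa using hn)
  simp only [Nat.card_fin] at h
  unfold None' numExcess
  simp only [← h]
  exact Nat.card_coe_set_eq _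

end

/-- `24 · N_1(n) / (n! · n²) → 1`, i.e. the constant `b_1` equals `1/12`. -/
theorem count_twoConnected_excess_one :
    Tendsto
      (fun n : ℕ => 24 * (None' n : ℝ) / ((n.factorial : ℝ) * (n : ℝ) ^ 2))
      atTop (nhds 1) := by
  have h1 : Tendsto (fun n : ℕ => (1 - 3 * (n : ℝ)⁻¹) * (1 + 2 * (n : ℝ)⁻¹)) atTop (nhds 1) := by
    have h := tendsto_inv_atTop_nhds_zero_nat (𝕜 := ℝ)
    simpa using ((h.const_mul 3).const_sub 1).mul ((h.const_mul 2).const_add 1)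
  refine h1.congr' ?_
  filter_upwards [eventually_ge_atTop 3] with n hn
  rw [None'_eq_numExcess hn]
  obtain ⟨m, rfl⟩ := Nat.exists_eq_add_of_le' hn
  have h2 : (24 * numExcess 1 (Fin (m + 3)) : ℝ) = (m + 3).factorial * (m * (m + 5)) := by
    exact_mod_cast numExcess_one m
  have h3 : ((m + 3).factorial : ℝ) ≠ 0 := by positivity
  rw [h2]
  push_cast
  have h4 : (m : ℝ) + 3 ≠ 0 := by positivity
  field_simp
  ring
end

section
/- The constant c_1 = ∫_0^∞ (1 − e^{−E_1(v)}) dv, with E_1(v) = (1/2)·∫_v^∞ e^{−t} t^{−1} dt, satisfies 0.3789 < c_1 < 0.3790. -/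
/-- `E_1(x) = (1/2) ∫_x^∞ e^{-t} t^{-1} dt`. -/
noncomputable def E1 (x : ℝ) : ℝ := (1 / 2) * ∫ t in Set.Ioi x, Real.exp (-t) / t

/-- `c_1 = ∫_0^∞ (1 - e^{-E_1(v)}) dv`. -/
noncomputable def c1 : ℝ := ∫ v in Set.Ioi (0 : ℝ), (1 - Real.exp (-(E1 v)))

open Set Filter Topology MeasureTheory Real

lemma integrableOn_exp_neg_div_Ioi {a : ℝ} (ha : 0 < a) :
    IntegrableOn (fun t : ℝ => exp (-t) / t) (Ioi a) := by
  have h : IntegrableOn (fun t : ℝ => exp (-t) / a) (Ioi a) :=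
    (integrableOn_exp_neg_Ioi a).div_const a
  refine Integrable.mono' h ?_ ?_
  · exact (by fun_prop : Measurable fun t : ℝ => exp (-t) / t).aestronglyMeasurable
  · filter_upwards [ae_restrict_mem measurableSet_Ioi] with t (ht : a < t)
    have : 0 < t := ha.trans ht
    rw [norm_of_nonneg (by positivity)]
    gcongr

lemma E1_nonneg {v : ℝ} (hv : 0 < v) : 0 ≤ E1 v := by
  unfold E1
  have : 0 ≤ ∫ t in Ioi v, exp (-t) / t :=
    setIntegral_nonneg measurableSet_Ioi fun t (ht : v < t) => by
      have : 0 < t := hv.trans ht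
      positivity
  positivity

lemma hasDerivAt_E1 {v : ℝ} (hv : 0 < v) : HasDerivAt E1 (-(exp (-v) / (2 * v))) v := by
  have ha : 0 < v / 2 := by positivity
  have hI := integrableOn_exp_neg_div_Ioi ha
  have heq : E1 =ᶠ[𝓝 v] fun x => (1 / 2) * ((∫ t in Ioi (v / 2), exp (-t) / t) -
      ∫ t in (v / 2)..x, exp (-t) / t) := by
    filter_upwards [lt_mem_nhds (half_lt_self hv)] with x hx
    rw [← intervalIntegral.integral_Ioi_sub_Ioi' hI (integrableOn_exp_neg_div_Ioi (ha.trans hx))]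
    unfold E1
    ring
  have hc : ContinuousAt (fun t : ℝ => exp (-t) / t) v := by
    have := hv.ne'
    fun_prop (disch := assumption)
  have hd : HasDerivAt (fun x => ∫ t in (v / 2)..x, exp (-t) / t) (exp (-v) / v) v := by
    refine intervalIntegral.integral_hasDerivAt_right ?_ ?_ hc
    · rw [intervalIntegrable_iff_integrableOn_Ioc_of_le (half_lt_self hv).le]
      exact hI.mono_set Ioc_subset_Ioi_self
    · exact ⟨univ, univ_mem, (by fun_prop :
        Measurable fun t : ℝ => exp (-t) / t).aestronglyMeasurable⟩
  refine (((hd.const_sub _).const_mul (1 / 2)).congr_of_eventuallyEq heq).congr_deriv ?_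
  field_simp

lemma E1_le_exp_neg_div {v : ℝ} (hv : 0 < v) : E1 v ≤ exp (-v) / (2 * v) := by
  have h : ∫ t in Ioi v, exp (-t) / t ≤ ∫ t in Ioi v, exp (-t) / v :=
    setIntegral_mono_on (integrableOn_exp_neg_div_Ioi hv)
      ((integrableOn_exp_neg_Ioi v).div_const v) measurableSet_Ioi
      fun t (ht : v < t) => by gcongr
  rw [integral_div, integral_exp_neg_Ioi] at h
  unfold E1
  calc _ ≤ 1 / 2 * (exp (-v) / v) := by gcongr
    _ = _ := by field_simp

lemma tendsto_exp_neg_atTop : Tendsto (fun v : ℝ => exp (-v)) atTop (𝓝 0) :=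
  tendsto_exp_atBot.comp tendsto_neg_atTop_atBot

lemma tendsto_mul_E1_atTop : Tendsto (fun v => v * E1 v) atTop (𝓝 0) := by
  refine squeeze_zero' ?_ ?_ tendsto_exp_neg_atTop
  · filter_upwards [eventually_gt_atTop 0] with v hv using mul_nonneg hv.le (E1_nonneg hv)
  · filter_upwards [eventually_gt_atTop 0] with v hv
    calc v * E1 v ≤ v * (exp (-v) / (2 * v)) := by gcongr; exact E1_le_exp_neg_div hv
      _ = exp (-v) / 2 := by field_simp
      _ ≤ exp (-v) := half_le_self (exp_pos _).le

lemma tendsto_E1_atTop : Tendsto E1 atTop (𝓝 0) := by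
  refine squeeze_zero' ?_ ?_ tendsto_mul_E1_atTop
  · filter_upwards [eventually_gt_atTop 0] with v hv using E1_nonneg hv
  · filter_upwards [eventually_ge_atTop 1] with v hv
    exact le_mul_of_one_le_left (E1_nonneg (by linarith)) hv

/-- A function on `[a, ∞)` with nonpositive derivative and limit `0` is nonnegative. -/
lemma nonneg_of_hasDerivAt_nonpos_of_tendsto {f f' : ℝ → ℝ} {a : ℝ}
    (hf : ∀ x, a ≤ x → HasDerivAt f (f' x) x) (hf' : ∀ x, a ≤ x → f' x ≤ 0)
    (hlim : Tendsto f atTop (𝓝 0)) : 0 ≤ f a := by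
  have hanti : AntitoneOn f (Ici a) := by
    refine antitoneOn_of_hasDerivWithinAt_nonpos (f' := f') (convex_Ici a)
      (fun x hx => (hf x hx).continuousAt.continuousWithinAt) ?_ ?_
    · intro x hx
      exact (hf x (interior_subset hx)).hasDerivWithinAt
    · intro x hx
      exact hf' x (interior_subset hx)
  refine le_of_tendsto hlim ?_
  filter_upwards [eventually_ge_atTop a] with x hx
  exact hanti self_mem_Ici hx hx

lemma tendsto_exp_neg_mul_of_abs_le {R : ℝ → ℝ} (hR : ∀ x, 1 ≤ x → |R x| ≤ 1) :
    Tendsto (fun v : ℝ => exp (-v) * R v) atTop (𝓝 0) := by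
  refine squeeze_zero_norm' ?_ tendsto_exp_neg_atTop
  filter_upwards [eventually_ge_atTop 1] with v hv
  rw [norm_mul, norm_of_nonneg (exp_pos _).le, norm_eq_abs]
  exact mul_le_of_le_one_right (exp_pos _).le (hR v hv)

lemma E1_le_exp_neg_mul {v : ℝ} (hv : 0 < v) :
    E1 v ≤ exp (-v) * ((v ^ 3 + 11 * v ^ 2 + 26 * v + 6) /
      (2 * (v * (v ^ 3 + 12 * v ^ 2 + 36 * v + 24)))) := by
  rw [← sub_nonneg]
  refine nonneg_of_hasDerivAt_nonpos_of_tendsto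
    (f := fun v => exp (-v) * ((v ^ 3 + 11 * v ^ 2 + 26 * v + 6) /
      (2 * (v * (v ^ 3 + 12 * v ^ 2 + 36 * v + 24)))) - E1 v)
    (f' := fun v => exp (-v) * (-72 / (v ^ 2 * (v ^ 3 + 12 * v ^ 2 + 36 * v + 24) ^ 2))) ?_ ?_ ?_
  · intro x hx
    have hx0 : 0 < x := hv.trans_le hx
    have hd : 2 * (x * (x ^ 3 + 12 * x ^ 2 + 36 * x + 24)) ≠ 0 := by positivity
    have h1 := (((((hasDerivAt_id x).pow 3).add (((hasDerivAt_id x).pow 2).const_mul 11)).add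
      ((hasDerivAt_id x).const_mul 26)).add_const 6).div
      (((hasDerivAt_id x).mul (((((hasDerivAt_id x).pow 3).add
      (((hasDerivAt_id x).pow 2).const_mul 12)).add
      ((hasDerivAt_id x).const_mul 36)).add_const 24)).const_mul 2) hd
    refine (((hasDerivAt_neg x).exp.mul h1).sub (hasDerivAt_E1 hx0)).congr_deriv ?_
    simp only [Pi.div_apply, Pi.add_apply, Pi.pow_apply, Pi.mul_apply, id]
    have : x ^ 3 + 12 * x ^ 2 + 36 * x + 24 ≠ 0 := by positivity
    field_simp
    ring
  · intro x hx
    have hx0 : 0 < x := hv.trans_le hx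
    have : 0 ≤ 72 / (x ^ 2 * (x ^ 3 + 12 * x ^ 2 + 36 * x + 24) ^ 2) := by positivity
    rw [neg_div]
    exact mul_nonpos_of_nonneg_of_nonpos (exp_pos _).le (by linarith)
  · rw [← sub_zero (0 : ℝ)]
    refine (tendsto_exp_neg_mul_of_abs_le fun x hx => ?_).sub tendsto_E1_atTop
    have hx0 : 0 < x := by linarith
    rw [abs_of_nonneg (by positivity), div_le_one (by positivity)]
    nlinarith [pow_pos hx0 2, pow_pos hx0 3, pow_pos hx0 4]

lemma exp_neg_mul_le_E1 {v : ℝ} (hv : 0 < v) :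
    exp (-v) * ((v + 3) / (2 * (v ^ 2 + 4 * v + 2))) ≤ E1 v := by
  rw [← sub_nonneg]
  refine nonneg_of_hasDerivAt_nonpos_of_tendsto
    (f := fun v => E1 v - exp (-v) * ((v + 3) / (2 * (v ^ 2 + 4 * v + 2))))
    (f' := fun v => -(exp (-v) * (2 / (v * (v ^ 2 + 4 * v + 2) ^ 2)))) ?_ ?_ ?_
  · intro x hx
    have hx0 : 0 < x := hv.trans_le hx
    have hd : 2 * (x ^ 2 + 4 * x + 2) ≠ 0 := by positivity
    have h1 := ((hasDerivAt_id x).add_const 3).div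
      (((((hasDerivAt_id x).pow 2).add ((hasDerivAt_id x).const_mul 4)).add_const 2).const_mul 2) hd
    refine ((hasDerivAt_E1 hx0).sub ((hasDerivAt_neg x).exp.mul h1)).congr_deriv ?_
    simp only [Pi.div_apply, Pi.add_apply, Pi.pow_apply, id]
    have : x ^ 2 + 4 * x + 2 ≠ 0 := by positivity
    field_simp
    ring
  · intro x hx
    have hx0 : 0 < x := hv.trans_le hx
    have : 0 ≤ exp (-x) * (2 / (x * (x ^ 2 + 4 * x + 2) ^ 2)) := by positivity
    linarith
  · rw [← sub_zero (0 : ℝ)]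
    refine tendsto_E1_atTop.sub (tendsto_exp_neg_mul_of_abs_le fun x hx => ?_)
    have hx0 : 0 < x := by linarith
    rw [abs_of_nonneg (by positivity), div_le_one (by positivity)]
    nlinarith [pow_pos hx0 2]

lemma continuousOn_E1 : ContinuousOn E1 (Ioi 0) := fun _ hv =>
  (hasDerivAt_E1 hv).continuousAt.continuousWithinAt

lemma integrableOn_E1_Ioi {a : ℝ} (ha : 0 < a) : IntegrableOn E1 (Ioi a) := by
  have h : IntegrableOn (fun t : ℝ => exp (-t) / (2 * a)) (Ioi a) :=
    (integrableOn_exp_neg_Ioi a).div_const _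
  refine Integrable.mono' h ?_ ?_
  · exact (continuousOn_E1.mono (Ioi_subset_Ioi ha.le)).aestronglyMeasurable measurableSet_Ioi
  · filter_upwards [ae_restrict_mem measurableSet_Ioi] with t (ht : a < t)
    have ht0 : 0 < t := ha.trans ht
    rw [norm_of_nonneg (E1_nonneg ht0)]
    refine (E1_le_exp_neg_div ht0).trans ?_
    gcongr

lemma one_sub_exp_neg_nonneg {x : ℝ} (hx : 0 ≤ x) : 0 ≤ 1 - exp (-x) := by
  simpa using hx

lemma one_sub_exp_neg_le (x : ℝ) : 1 - exp (-x) ≤ x := by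
  linarith [add_one_le_exp (-x)]

lemma continuousOn_exp_neg_E1 : ContinuousOn (fun v => exp (-(E1 v))) (Ioi 0) :=
  continuousOn_E1.neg.rexp

lemma integrableOn_one_sub_exp_neg_E1_Ioi {a : ℝ} (ha : 0 < a) :
    IntegrableOn (fun v => 1 - exp (-(E1 v))) (Ioi a) := by
  refine Integrable.mono' (integrableOn_E1_Ioi ha) ?_ ?_
  · exact (continuousOn_const.sub (continuousOn_exp_neg_E1.mono
      (Ioi_subset_Ioi ha.le))).aestronglyMeasurable measurableSet_Ioi
  · filter_upwards [ae_restrict_mem measurableSet_Ioi] with t (ht : a < t)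
    rw [norm_of_nonneg (one_sub_exp_neg_nonneg (E1_nonneg (ha.trans ht)))]
    exact one_sub_exp_neg_le _

lemma integrableOn_exp_neg_E1_Ioc (a : ℝ) :
    IntegrableOn (fun v => exp (-(E1 v))) (Ioc 0 a) := by
  refine Integrable.mono' (g := fun _ => (1 : ℝ)) (by simp) ?_ ?_
  · exact (continuousOn_exp_neg_E1.mono Ioc_subset_Ioi_self).aestronglyMeasurable measurableSet_Ioc
  · filter_upwards [ae_restrict_mem measurableSet_Ioc] with t ht
    rw [norm_of_nonneg (exp_pos _).le, exp_le_one_iff, neg_nonpos]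
    exact E1_nonneg ht.1

lemma c1_eq_sub_add {a : ℝ} (ha : 0 < a) :
    c1 = a - (∫ v in (0)..a, exp (-(E1 v))) + ∫ v in Ioi a, (1 - exp (-(E1 v))) := by
  have h1 := integrableOn_exp_neg_E1_Ioc a
  have h2 : IntegrableOn (fun _ : ℝ => (1 : ℝ)) (Ioc 0 a) := by simp
  have h3 : IntegrableOn (fun v => 1 - exp (-(E1 v))) (Ioc 0 a) := h2.sub h1
  unfold c1
  rw [← Ioc_union_Ioi_eq_Ioi ha.le, setIntegral_union (Ioc_disjoint_Ioi le_rfl) measurableSet_Ioi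
    h3 (integrableOn_one_sub_exp_neg_E1_Ioi ha), integral_sub h2 h1,
    intervalIntegral.integral_of_le ha.le]
  simp [ha.le]

lemma hasDerivAt_mul_E1_sub {v : ℝ} (hv : 0 < v) :
    HasDerivAt (fun v => v * E1 v - exp (-v) / 2) (E1 v) v := by
  refine (((hasDerivAt_id v).mul (hasDerivAt_E1 hv)).sub
    ((hasDerivAt_neg v).exp.div_const 2)).congr_deriv ?_
  simp only [id]
  field_simp
  ring

lemma tendsto_mul_E1_sub : Tendsto (fun v => v * E1 v - exp (-v) / 2) atTop (𝓝 0) := by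
  simpa using tendsto_mul_E1_atTop.sub (tendsto_exp_neg_atTop.div_const 2)

lemma integral_one_sub_exp_neg_E1_le {a : ℝ} (ha : 0 < a) :
    ∫ v in Ioi a, (1 - exp (-(E1 v))) ≤ exp (-a) / 2 - a * E1 a := by
  have h : ∫ v in Ioi a, E1 v = 0 - (a * E1 a - exp (-a) / 2) :=
    integral_Ioi_of_hasDerivAt_of_tendsto' (f := fun v => v * E1 v - exp (-v) / 2)
      (fun x hx => hasDerivAt_mul_E1_sub (ha.trans_le hx)) (integrableOn_E1_Ioi ha)
      tendsto_mul_E1_sub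
  calc _ ≤ ∫ v in Ioi a, E1 v :=
        setIntegral_mono_on (integrableOn_one_sub_exp_neg_E1_Ioi ha) (integrableOn_E1_Ioi ha)
          measurableSet_Ioi fun v _ => one_sub_exp_neg_le _
    _ = _ := by rw [h]; ring

/-- The partial sums of the exponential series of `e^{-x}` are alternately below and above it. -/
lemma neg_one_pow_mul_exp_neg_sub_nonneg (n : ℕ) {x : ℝ} (hx : 0 ≤ x) :
    0 ≤ (-1) ^ n * (exp (-x) - ∑ k ∈ Finset.range n, (-x) ^ k / k.factorial) := by
  induction n generalizing x with
  | zero => simp [(exp_pos _).le]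
  | succ n ih =>
    have hd : ∀ y : ℝ, HasDerivAt
        (fun x : ℝ => (-1) ^ (n + 1) *
          (exp (-x) - ∑ k ∈ Finset.range (n + 1), (-x) ^ k / k.factorial))
        ((-1) ^ n * (exp (-y) - ∑ k ∈ Finset.range n, (-y) ^ k / k.factorial)) y := by
      intro y
      have hs : HasDerivAt (fun x : ℝ => ∑ k ∈ Finset.range (n + 1), (-x) ^ k / k.factorial)
          (∑ k ∈ Finset.range (n + 1), (k * (-y) ^ (k - 1) * -1) / k.factorial) y :=
        HasDerivAt.fun_sum fun k _ => ((hasDerivAt_neg y).fun_pow k).div_const _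
      refine (((hasDerivAt_neg y).exp.sub hs).const_mul _).congr_deriv ?_
      have : ∑ k ∈ Finset.range (n + 1), ((k : ℝ) * (-y) ^ (k - 1) * -1) / k.factorial =
          -∑ k ∈ Finset.range n, (-y) ^ k / k.factorial := by
        rw [Finset.sum_range_succ', ← Finset.sum_neg_distrib]
        simp only [Nat.cast_zero, zero_mul, zero_div, add_zero]
        refine Finset.sum_congr rfl fun k _ => ?_
        rw [Nat.factorial_succ]
        have : (k.factorial : ℝ) ≠ 0 := by positivity
        push_cast
        field_simp
      rw [this]
      ring
    have hmono := monotoneOn_of_hasDerivWithinAt_nonneg (convex_Ici (0 : ℝ))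
      (fun y _ => (hd y).continuousAt.continuousWithinAt)
      (fun y _ => (hd y).hasDerivWithinAt)
      (fun y hy => ih (interior_subset hy))
    have := hmono self_mem_Ici hx hx
    simpa [Finset.sum_range_succ'] using this

lemma sub_sq_half_le_one_sub_exp_neg {x : ℝ} (hx : 0 ≤ x) : x - x ^ 2 / 2 ≤ 1 - exp (-x) := by
  have := neg_one_pow_mul_exp_neg_sub_nonneg 3 hx
  norm_num [Finset.sum_range_succ, Nat.factorial] at this
  linarith

lemma le_integral_one_sub_exp_neg_E1 {a : ℝ} (ha : 0 < a) :
    exp (-a) / 2 - a * E1 a - E1 a ^ 2 / 4 ≤ ∫ v in Ioi a, (1 - exp (-(E1 v))) := by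
  set f' : ℝ → ℝ := fun v => E1 v - E1 v * exp (-v) / (4 * v)
  have hd : ∀ v ∈ Ici a, HasDerivAt (fun v => v * E1 v - exp (-v) / 2 + E1 v ^ 2 / 4) (f' v) v := by
    intro v hv
    have hv0 : 0 < v := ha.trans_le hv
    refine ((hasDerivAt_mul_E1_sub hv0).add (((hasDerivAt_E1 hv0).fun_pow 2).div_const 4)).congr_deriv ?_
    simp only [f']
    field_simp
    ring
  have hlim : Tendsto (fun v => v * E1 v - exp (-v) / 2 + E1 v ^ 2 / 4) atTop (𝓝 0) := by
    simpa using tendsto_mul_E1_sub.add ((tendsto_E1_atTop.pow 2).div_const 4)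
  have hle : ∀ v ∈ Ioi a, f' v ≤ 1 - exp (-(E1 v)) := by
    intro v hv
    have hv0 : 0 < v := ha.trans hv
    have h0 := E1_nonneg hv0
    refine le_trans ?_ (sub_sq_half_le_one_sub_exp_neg h0)
    have h1 := mul_le_mul_of_nonneg_left (E1_le_exp_neg_div hv0) h0
    have h2 : E1 v * exp (-v) / (4 * v) = E1 v * (exp (-v) / (2 * v)) / 2 := by field_simp; norm_num
    simp only [f', h2]
    linarith
  have hint : IntegrableOn f' (Ioi a) := by
    have hc : ContinuousOn f' (Ioi a) := by
      have h1 := continuousOn_E1.mono (Ioi_subset_Ioi ha.le)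
      refine h1.sub ((h1.mul (by fun_prop)).div (by fun_prop) fun v (hv : a < v) => ?_)
      have : 0 < v := ha.trans hv
      positivity
    refine Integrable.mono' ((integrableOn_E1_Ioi ha).const_mul (1 + 1 / (4 * a)))
      (hc.aestronglyMeasurable measurableSet_Ioi) ?_
    filter_upwards [ae_restrict_mem measurableSet_Ioi] with v (hv : a < v)
    have hv0 : 0 < v := ha.trans hv
    have h0 := E1_nonneg hv0
    have h1 : E1 v * exp (-v) / (4 * v) ≤ E1 v * 1 / (4 * a) := by
      gcongr
      simpa using hv0.le
    have h2 : 0 ≤ E1 v * exp (-v) / (4 * v) := by positivity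
    have h3 : 0 ≤ E1 v * 1 / (4 * a) := by positivity
    have h4 : (1 + 1 / (4 * a)) * E1 v = E1 v + E1 v * 1 / (4 * a) := by ring
    rw [h4, norm_eq_abs, abs_le]
    simp only [f']
    constructor <;> linarith
  have h := integral_Ioi_of_hasDerivAt_of_tendsto' hd hint hlim
  calc _ = ∫ v in Ioi a, f' v := by rw [h]; ring
    _ ≤ _ := setIntegral_mono_on hint (integrableOn_one_sub_exp_neg_E1_Ioi ha) measurableSet_Ioi hle

lemma continuousOn_mul_exp_neg_E1_mul {S : ℝ → ℝ} (hS : Continuous S) (a : ℝ) :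
    ContinuousOn (fun v => v * exp (-(E1 v)) * S v) (Icc 0 a) := by
  refine ContinuousOn.mul (fun v hv => ?_) hS.continuousOn
  rcases hv.1.eq_or_lt with rfl | h
  · have : Tendsto (fun v : ℝ => v * exp (-(E1 v))) (𝓝[Icc 0 a] 0) (𝓝 0) := by
      refine squeeze_zero' ?_ ?_ ((continuous_id.tendsto (0 : ℝ)).mono_left nhdsWithin_le_nhds)
      · filter_upwards [self_mem_nhdsWithin] with v hv using mul_nonneg hv.1 (exp_pos _).le
      · filter_upwards [self_mem_nhdsWithin] with v hv
        rcases hv.1.eq_or_lt with rfl | h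
        · simp
        · exact mul_le_of_le_one_right hv.1 (by simpa using E1_nonneg h)
    simpa [ContinuousWithinAt] using this
  · exact (continuousAt_id.mul
      (hasDerivAt_E1 h).continuousAt.neg.rexp).continuousWithinAt

lemma hasDerivAt_mul_exp_neg_E1_mul {S S' : ℝ → ℝ} {v : ℝ} (hv : 0 < v)
    (hS : HasDerivAt S (S' v) v) : HasDerivAt (fun v => v * exp (-(E1 v)) * S v)
      (exp (-(E1 v)) * (S v * (1 + exp (-v) / 2) + v * S' v)) v := by
  refine (((hasDerivAt_id v).mul (hasDerivAt_E1 hv).neg.exp).mul hS).congr_deriv ?_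
  simp only [id, Pi.mul_apply, Pi.neg_apply]
  field_simp

lemma integral_exp_neg_E1_le {S S' : ℝ → ℝ} {a : ℝ} (ha : 0 ≤ a)
    (hS : ∀ v, HasDerivAt S (S' v) v)
    (h : ∀ v ∈ Ioo 0 a, 1 ≤ S v * (1 + exp (-v) / 2) + v * S' v) :
    ∫ v in (0)..a, exp (-(E1 v)) ≤ a * exp (-(E1 a)) * S a := by
  have := intervalIntegral.integral_le_sub_of_hasDeriv_right_of_le ha
    (continuousOn_mul_exp_neg_E1_mul
      (continuous_iff_continuousAt.2 fun v => (hS v).continuousAt) a)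
    (fun v hv => (hasDerivAt_mul_exp_neg_E1_mul hv.1 (hS v)).hasDerivWithinAt)
    ((integrableOn_Icc_iff_integrableOn_Ioc (by simp)).2 (integrableOn_exp_neg_E1_Ioc a))
    (fun v hv => le_mul_of_one_le_right (exp_pos _).le (h v hv))
  simpa using this

lemma le_integral_exp_neg_E1 {S S' : ℝ → ℝ} {a : ℝ} (ha : 0 ≤ a)
    (hS : ∀ v, HasDerivAt S (S' v) v)
    (h : ∀ v ∈ Ioo 0 a, S v * (1 + exp (-v) / 2) + v * S' v ≤ 1) :
    a * exp (-(E1 a)) * S a ≤ ∫ v in (0)..a, exp (-(E1 v)) := by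
  have := intervalIntegral.sub_le_integral_of_hasDeriv_right_of_le ha
    (continuousOn_mul_exp_neg_E1_mul
      (continuous_iff_continuousAt.2 fun v => (hS v).continuousAt) a)
    (fun v hv => (hasDerivAt_mul_exp_neg_E1_mul hv.1 (hS v)).hasDerivWithinAt)
    ((integrableOn_Icc_iff_integrableOn_Ioc (by simp)).2 (integrableOn_exp_neg_E1_Ioc a))
    (fun v hv => mul_le_of_le_one_right (exp_pos _).le (h v hv))
  simpa using this

lemma hasDerivAt_sum_mul_pow {n : ℕ} (c : Fin n → ℝ) (s : ℝ) :
    HasDerivAt (fun s : ℝ => ∑ k, c k * s ^ (k : ℕ)) (∑ k, c k * (k * s ^ ((k : ℕ) - 1))) s :=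
  HasDerivAt.fun_sum fun k _ => (hasDerivAt_pow (k : ℕ) s).const_mul (c k)

lemma hasDerivAt_sum_mul_pow_comp {n : ℕ} (c : Fin n → ℝ) (v : ℝ) :
    HasDerivAt (fun v : ℝ => ∑ k, c k * ((2 * v - 3) / 3) ^ (k : ℕ))
      ((∑ k, c k * (k * ((2 * v - 3) / 3) ^ ((k : ℕ) - 1))) * (2 / 3)) v := by
  have h : HasDerivAt (fun v : ℝ => (2 * v - 3) / 3) (2 / 3) v := by
    simpa using (((hasDerivAt_id v).const_mul 2).sub_const 3).div_const 3
  exact (hasDerivAt_sum_mul_pow c ((2 * v - 3) / 3)).comp v h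

lemma integral_exp_neg_E1_le_of_polynomial {n : ℕ} (c : Fin n → ℝ)
    (h : ∀ s, |s| ≤ 1 → 1 ≤ (∑ k, c k * s ^ (k : ℕ)) * (1 + exp (-(3 / 2 * (1 + s))) / 2) +
      (1 + s) * ∑ k, c k * (k * s ^ ((k : ℕ) - 1))) :
    ∫ v in (0)..3, exp (-(E1 v)) ≤ 3 * exp (-(E1 3)) * ∑ k, c k := by
  have := integral_exp_neg_E1_le (by norm_num : (0 : ℝ) ≤ 3) (hasDerivAt_sum_mul_pow_comp c) ?_
  · norm_num at this
    exact this
  · intro v hv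
    refine (h ((2 * v - 3) / 3) (abs_le.2 ⟨by linarith [hv.1], by linarith [hv.2]⟩)).trans_eq ?_
    rw [show 3 / 2 * (1 + (2 * v - 3) / 3) = v by ring]
    ring

lemma le_integral_exp_neg_E1_of_polynomial {n : ℕ} (c : Fin n → ℝ)
    (h : ∀ s, |s| ≤ 1 → (∑ k, c k * s ^ (k : ℕ)) * (1 + exp (-(3 / 2 * (1 + s))) / 2) +
      (1 + s) * ∑ k, c k * (k * s ^ ((k : ℕ) - 1)) ≤ 1) :
    3 * exp (-(E1 3)) * ∑ k, c k ≤ ∫ v in (0)..3, exp (-(E1 v)) := by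
  have := le_integral_exp_neg_E1 (by norm_num : (0 : ℝ) ≤ 3) (hasDerivAt_sum_mul_pow_comp c) ?_
  · norm_num at this
    exact this
  · intro v hv
    refine Eq.trans_le ?_ (h ((2 * v - 3) / 3) (abs_le.2 ⟨by linarith [hv.1], by linarith [hv.2]⟩))
    rw [show 3 / 2 * (1 + (2 * v - 3) / 3) = v by ring]
    ring

/-- Coefficients in `s = (2 * v - 3) / 3` of a polynomial supersolution of
`S v * (1 + exp (-v) / 2) + v * S' v = 1` on `[0, 3]`. -/
noncomputable def superCoeff : Fin 13 → ℝ := fun k =>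
  (![81103088, 9848740, -3611923, 902530, -115432, -19230, 16513,
    -5448, 1085, -71, -44, 23, -7] : Fin 13 → ℝ) k / 10 ^ 8

set_option maxHeartbeats 1000000 in
lemma integral_exp_neg_E1_le_mul :
    ∫ v in (0)..3, exp (-(E1 v)) ≤ 2.6435948 * exp (-(E1 3)) := by
  have h := integral_exp_neg_E1_le_of_polynomial superCoeff ?_
  · norm_num [superCoeff, Fin.sum_univ_succ] at h ⊢
    linarith [exp_pos (-(E1 3))]
  intro s hs1
  have hs (k : ℕ) : -1 ≤ s ^ k ∧ s ^ k ≤ 1 :=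
    abs_le.1 (by simpa [abs_pow] using pow_le_one₀ (n := k) (abs_nonneg s) hs1)
  have hT := neg_one_pow_mul_exp_neg_sub_nonneg 18 (x := 3 / 2 * (1 + s))
    (by linarith [(abs_le.1 hs1).1])
  have hp : 0 ≤ ∑ k, superCoeff k * s ^ (k : ℕ) := by
    simp [superCoeff, Fin.sum_univ_succ]
    linarith [(hs 1).1, (hs 1).2, (hs 2).1, (hs 2).2, (hs 3).1, (hs 3).2, (hs 4).1, (hs 4).2,
      (hs 5).1, (hs 5).2, (hs 6).1, (hs 6).2, (hs 7).1, (hs 7).2, (hs 8).1, (hs 8).2,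
      (hs 9).1, (hs 9).2, (hs 10).1, (hs 10).2, (hs 11).1, (hs 11).2, (hs 12).1, (hs 12).2]
  have hm := mul_nonneg hp (by linarith : 0 ≤ exp (-(3 / 2 * (1 + s))) -
    ∑ k ∈ Finset.range 18, (-(3 / 2 * (1 + s))) ^ k / k.factorial)
  suffices 1 ≤ (∑ k, superCoeff k * s ^ (k : ℕ)) *
      (1 + (∑ k ∈ Finset.range 18, (-(3 / 2 * (1 + s))) ^ k / k.factorial) / 2) +
      (1 + s) * ∑ k, superCoeff k * (k * s ^ ((k : ℕ) - 1)) by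
    linarith
  clear hm hp hT
  simp [superCoeff, Finset.sum_range_succ, Fin.sum_univ_succ, Nat.factorial]
  linarith [(hs 1).1, (hs 1).2, (hs 2).1, (hs 2).2, (hs 3).1, (hs 3).2, (hs 4).1, (hs 4).2,
      (hs 5).1, (hs 5).2, (hs 6).1, (hs 6).2, (hs 7).1, (hs 7).2, (hs 8).1, (hs 8).2,
      (hs 9).1, (hs 9).2, (hs 10).1, (hs 10).2, (hs 11).1, (hs 11).2, (hs 12).1, (hs 12).2,
      (hs 13).1, (hs 13).2, (hs 14).1, (hs 14).2, (hs 15).1, (hs 15).2, (hs 16).1, (hs 16).2,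
      (hs 17).1, (hs 17).2, (hs 18).1, (hs 18).2, (hs 19).1, (hs 19).2, (hs 20).1, (hs 20).2,
      (hs 21).1, (hs 21).2, (hs 22).1, (hs 22).2, (hs 23).1, (hs 23).2, (hs 24).1, (hs 24).2,
      (hs 25).1, (hs 25).2, (hs 26).1, (hs 26).2, (hs 27).1, (hs 27).2,
      (hs 28).1, (hs 28).2, (hs 29).1, (hs 29).2]

/-- Coefficients in `s = (2 * v - 3) / 3` of a polynomial subsolution of
`S v * (1 + exp (-v) / 2) + v * S' v = 1` on `[0, 3]`. -/
noncomputable def subCoeff : Fin 10 → ℝ := fun k =>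
  (![8110138, 984853, -361185, 90251, -11543, -1923, 1651, -545, 108, -7] : Fin 10 → ℝ) k / 10 ^ 7

set_option maxHeartbeats 1000000 in
lemma mul_le_integral_exp_neg_E1 :
    2.6435393 * exp (-(E1 3)) ≤ ∫ v in (0)..3, exp (-(E1 v)) := by
  have h := le_integral_exp_neg_E1_of_polynomial subCoeff ?_
  · norm_num [subCoeff, Fin.sum_univ_succ] at h ⊢
    linarith [exp_pos (-(E1 3))]
  intro s hs1
  have hs (k : ℕ) : -1 ≤ s ^ k ∧ s ^ k ≤ 1 :=
    abs_le.1 (by simpa [abs_pow] using pow_le_one₀ (n := k) (abs_nonneg s) hs1)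
  have hT := neg_one_pow_mul_exp_neg_sub_nonneg 15 (x := 3 / 2 * (1 + s))
    (by linarith [(abs_le.1 hs1).1])
  have hp : 0 ≤ ∑ k, subCoeff k * s ^ (k : ℕ) := by
    simp [subCoeff, Fin.sum_univ_succ]
    linarith [(hs 1).1, (hs 1).2, (hs 2).1, (hs 2).2, (hs 3).1, (hs 3).2, (hs 4).1, (hs 4).2,
      (hs 5).1, (hs 5).2, (hs 6).1, (hs 6).2, (hs 7).1, (hs 7).2, (hs 8).1, (hs 8).2,
      (hs 9).1, (hs 9).2]
  have hm := mul_nonneg hp (by linarith :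
    0 ≤ (∑ k ∈ Finset.range 15, (-(3 / 2 * (1 + s))) ^ k / k.factorial) -
      exp (-(3 / 2 * (1 + s))))
  suffices (∑ k, subCoeff k * s ^ (k : ℕ)) *
      (1 + (∑ k ∈ Finset.range 15, (-(3 / 2 * (1 + s))) ^ k / k.factorial) / 2) +
      (1 + s) * ∑ k, subCoeff k * (k * s ^ ((k : ℕ) - 1)) ≤ 1 by
    linarith
  clear hm hp hT
  simp [subCoeff, Finset.sum_range_succ, Fin.sum_univ_succ, Nat.factorial]
  linarith [(hs 1).1, (hs 1).2, (hs 2).1, (hs 2).2, (hs 3).1, (hs 3).2, (hs 4).1, (hs 4).2,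
      (hs 5).1, (hs 5).2, (hs 6).1, (hs 6).2, (hs 7).1, (hs 7).2, (hs 8).1, (hs 8).2,
      (hs 9).1, (hs 9).2, (hs 10).1, (hs 10).2, (hs 11).1, (hs 11).2, (hs 12).1, (hs 12).2,
      (hs 13).1, (hs 13).2, (hs 14).1, (hs 14).2, (hs 15).1, (hs 15).2, (hs 16).1, (hs 16).2,
      (hs 17).1, (hs 17).2, (hs 18).1, (hs 18).2, (hs 19).1, (hs 19).2, (hs 20).1, (hs 20).2,
      (hs 21).1, (hs 21).2, (hs 22).1, (hs 22).2, (hs 23).1, (hs 23).2]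

lemma exp_neg_three_bounds : 0.04978706 < exp (-3) ∧ exp (-3) < 0.04978707 := by
  have h : exp (-3) = (exp 1 ^ 3)⁻¹ := by
    rw [exp_neg, ← exp_nat_mul]
    norm_num
  have h1 := exp_one_gt_d9
  have h2 := exp_one_lt_d9
  rw [h]
  constructor
  · rw [lt_inv_comm₀ (by norm_num) (by positivity)]
    calc exp 1 ^ 3 < 2.7182818286 ^ 3 := by gcongr
      _ < _ := by norm_num
  · rw [inv_lt_comm₀ (by positivity) (by norm_num)]
    calc _ < (2.7182818283 : ℝ) ^ 3 := by norm_num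
      _ < _ := by gcongr

lemma E1_three_bounds : 0.0064939 < E1 3 ∧ E1 3 < 0.0065265 := by
  have h1 := exp_neg_mul_le_E1 (v := 3) (by norm_num)
  have h2 := E1_le_exp_neg_mul (v := 3) (by norm_num)
  obtain ⟨h3, h4⟩ := exp_neg_three_bounds
  norm_num at h1 h2 h3 h4 ⊢
  constructor <;> linarith

lemma exp_neg_le_of_nonneg {x : ℝ} (hx : 0 ≤ x) : exp (-x) ≤ 1 - x + x ^ 2 / 2 := by
  linarith [sub_sq_half_le_one_sub_exp_neg hx]

lemma le_exp_neg_of_nonneg {x : ℝ} (hx : 0 ≤ x) : 1 - x + x ^ 2 / 2 - x ^ 3 / 6 ≤ exp (-x) := by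
  have := neg_one_pow_mul_exp_neg_sub_nonneg 4 hx
  norm_num [Finset.sum_range_succ, Nat.factorial] at this
  linarith

/-- Numerical bounds: `0.3789 < c_1 < 0.3790`. -/
theorem c1_bounds : 0.3789 < c1 ∧ c1 < 0.3790 := by
  obtain ⟨he1, he2⟩ := exp_neg_three_bounds
  obtain ⟨hx1, hx2⟩ := E1_three_bounds
  have hx0 : 0 ≤ E1 3 := by linarith
  have hc := c1_eq_sub_add (a := 3) (by norm_num)
  have hup := integral_exp_neg_E1_le_mul
  have hlo := mul_le_integral_exp_neg_E1
  have htup := integral_one_sub_exp_neg_E1_le (a := 3) (by norm_num)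
  have htlo := le_integral_one_sub_exp_neg_E1 (a := 3) (by norm_num)
  have hgup := exp_neg_le_of_nonneg hx0
  have hglo := le_exp_neg_of_nonneg hx0
  have hsq1 := mul_nonneg (sub_nonneg.2 hx1.le) (sub_nonneg.2 hx2.le)
  have hsq2 := mul_self_nonneg (E1 3 - 0.0064939)
  have hcube : E1 3 ^ 3 ≤ 0.0065265 ^ 3 := by gcongr
  norm_num at *
  constructor <;> nlinarith
end
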